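/- arXiv:1603.08447 — 3 statements merged into one kernel-verified Lean document; each statement's English description precedes it below -/
import Mathlib

section
/- If moreover i_L(m) ≥ i_L(m̂) for every m ∈ ℝ (i.e. the minimizer of i_L coincides with m̂), then lim_{n→∞} I(x*;Y)/n exists and equals i_B(m̂) = min_{m≥0} i_B(m); that is, the Bethe mutual information is asymptotically exact. -/
open MeasureTheory ProbabilityTheory Filter Real

noncomputable section

/-- Index set of pairs `1 ≤ i ≤ j ≤ n`. -/
abbrev SymIdx (n : ℕ) := {q : Fin n × Fin n // q.1 ≤ q.2}

/-- Kullback–Leibler divergence, expressed as the integral of the log-likelihood ratio. -/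
def klDivR {α : Type*} [MeasurableSpace α] (μ ν : Measure α) : ℝ := ∫ a, llr μ ν a ∂μ

/-- Mutual information of a joint law on a product space: the KL divergence between the
joint law and the product of its marginals. -/
def mutualInfoR {α β : Type*} [MeasurableSpace α] [MeasurableSpace β]
    (μ : Measure (α × β)) : ℝ := klDivR μ (μ.fst.prod μ.snd)

/-- Joint law of `(x*, Y)` for the Gaussian channel `Y_{ij} = x*_i x*_j/√n + √Δ ξ_{ij}`,
where `x*` has i.i.d. coordinates of law `p` and `ξ` is i.i.d. standard Gaussian. -/
def gaussJoint (p : Measure ℝ) (Δ : ℝ) (n : ℕ) :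
    Measure ((Fin n → ℝ) × (SymIdx n → ℝ)) :=
  ((Measure.pi fun _ : Fin n => p).prod
      (Measure.pi fun _ : SymIdx n => gaussianReal 0 1)).map
    (fun w => (w.1, fun q : SymIdx n =>
      w.1 q.1.1 * w.1 q.1.2 / Real.sqrt n + Real.sqrt Δ * w.2 q))

/-- The mutual information `I(x*; Y)` for the Gaussian channel. -/
def MI (p : Measure ℝ) (Δ : ℝ) (n : ℕ) : ℝ := mutualInfoR (gaussJoint p Δ n)

/-- `J(A,B) = log ∫ exp(Bx - A x²/2) p(dx)`. -/
def Jf (p : Measure ℝ) (A B : ℝ) : ℝ := Real.log (∫ x, Real.exp (B * x - A * x ^ 2 / 2) ∂p)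

/-- The Bethe mutual information `i_B(m)`. -/
def iB (p : Measure ℝ) (Δ m : ℝ) : ℝ :=
  (m ^ 2 + (∫ x, x ^ 2 ∂p) ^ 2) / (4 * Δ)
    - ∫ w : ℝ × ℝ, Jf p (m / Δ) (m * w.1 / Δ + Real.sqrt (m / Δ) * w.2)
        ∂(p.prod (gaussianReal 0 1))


/-- The lower-bound functional `i_L(m)` built from a minimizer `m̂` of `i_B`. -/
def iL (p : Measure ℝ) (Δ mhat m : ℝ) : ℝ :=
  (2 * m ^ 2 - mhat ^ 2 + (∫ x, x ^ 2 ∂p) ^ 2) / (4 * Δ)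
    - ∫ w : ℝ × ℝ, Jf p (mhat / Δ) (m * w.1 / Δ + Real.sqrt (mhat / Δ) * w.2)
        ∂(p.prod (gaussianReal 0 1))

/-- The standard Gaussian measure on `ℝ^K`. -/
abbrev stdGaussianPi (K : Type*) [Fintype K] : Measure (K → ℝ) :=
  Measure.pi fun _ : K => gaussianReal 0 1

/-- A family of functions on `ℝ^K` with a common exponential bound. -/
def ExpGrowth {ι K : Type*} [Fintype K] (f : ι → (K → ℝ) → ℝ) : Prop :=
  ∃ C c : ℝ, 0 ≤ C ∧ 0 ≤ c ∧ ∀ i g, |f i g| ≤ C * Real.exp (c * ∑ k, |g k|)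

namespace ExpGrowth

variable {ι K : Type*} [Fintype K] {f h : ι → (K → ℝ) → ℝ}

lemma mono (hh : ExpGrowth h) (hfh : ∀ i g, |f i g| ≤ |h i g|) : ExpGrowth f := by
  obtain ⟨C, c, hC, hc, H⟩ := hh
  exact ⟨C, c, hC, hc, fun i g => (hfh i g).trans (H i g)⟩

lemma of_bounded {C : ℝ} (hf : ∀ i g, |f i g| ≤ C) : ExpGrowth f :=
  ⟨max C 0, 0, le_max_right _ _, le_rfl, fun i g => by
    simpa using Or.inl (hf i g)⟩

lemma mul (hf : ExpGrowth f) (hh : ExpGrowth h) : ExpGrowth fun i g => f i g * h i g := by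
  obtain ⟨C, c, hC, hc, H⟩ := hf
  obtain ⟨D, d, hD, hd, H'⟩ := hh
  refine ⟨C * D, c + d, by positivity, by positivity, fun i g => ?_⟩
  rw [abs_mul, add_mul, Real.exp_add]
  calc _ ≤ (C * Real.exp (c * ∑ k, |g k|)) * (D * Real.exp (d * ∑ k, |g k|)) :=
        mul_le_mul (H i g) (H' i g) (abs_nonneg _) (by positivity)
    _ = _ := by ring

lemma add (hf : ExpGrowth f) (hh : ExpGrowth h) : ExpGrowth fun i g => f i g + h i g := by
  obtain ⟨C, c, hC, hc, H⟩ := hf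
  obtain ⟨D, d, hD, hd, H'⟩ := hh
  refine ⟨C + D, c + d, by positivity, by positivity, fun i g => ?_⟩
  have hN : 0 ≤ ∑ k, |g k| := Finset.sum_nonneg fun _ _ => abs_nonneg _
  calc _ ≤ |f i g| + |h i g| := abs_add_le _ _
    _ ≤ C * Real.exp (c * ∑ k, |g k|) + D * Real.exp (d * ∑ k, |g k|) :=
        add_le_add (H i g) (H' i g)
    _ ≤ C * Real.exp ((c + d) * ∑ k, |g k|) + D * Real.exp ((c + d) * ∑ k, |g k|) := by
        gcongr <;> linarith
    _ = _ := by ring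

lemma neg (hf : ExpGrowth f) : ExpGrowth fun i g => - f i g :=
  hf.mono fun i g => by simp

lemma sub (hf : ExpGrowth f) (hh : ExpGrowth h) : ExpGrowth fun i g => f i g - h i g := by
  simpa only [sub_eq_add_neg] using hf.add hh.neg

lemma const (a : ℝ) : ExpGrowth (ι := ι) (K := K) fun _ _ => a :=
  of_bounded (C := |a|) fun _ _ => le_rfl

lemma const_mul (a : ℝ) (hf : ExpGrowth f) : ExpGrowth fun i g => a * f i g :=
  (const a).mul hf

lemma sum {α : Type*} (s : Finset α) {f : α → ι → (K → ℝ) → ℝ} (hf : ∀ a ∈ s, ExpGrowth (f a)) :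
    ExpGrowth fun i g => ∑ a ∈ s, f a i g := by
  classical
  induction s using Finset.induction_on with
  | empty => simpa using const (ι := ι) (K := K) 0
  | insert a s ha ih =>
    simp only [Finset.sum_insert ha]
    exact (hf a (Finset.mem_insert_self a s)).add
      (ih fun b hb => hf b (Finset.mem_insert_of_mem hb))

lemma pow (hf : ExpGrowth f) (n : ℕ) : ExpGrowth fun i g => f i g ^ n := by
  induction n with
  | zero => simpa using const (ι := ι) (K := K) 1
  | succ n ih => simpa only [pow_succ] using ih.mul hf

lemma coord (k : K) : ExpGrowth (ι := ι) fun _ g => g k := by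
  refine ⟨1, 1, zero_le_one, zero_le_one, fun i g => ?_⟩
  rw [one_mul, one_mul]
  calc |g k| ≤ ∑ k, |g k| :=
        Finset.single_le_sum (f := fun k => |g k|) (fun _ _ => abs_nonneg _) (Finset.mem_univ k)
    _ ≤ _ := by linarith [Real.add_one_le_exp (∑ k, |g k|)]

end ExpGrowth

lemma integrable_exp_mul_abs_gaussianReal (c : ℝ) :
    Integrable (fun s => Real.exp (c * |s|)) (gaussianReal 0 1) :=
  integrable_exp_mul_abs (X := id) (integrable_exp_mul_gaussianReal _)
    (integrable_exp_mul_gaussianReal _)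

lemma integrable_exp_mul_sum_abs {K : Type*} [Fintype K] (C c : ℝ) :
    Integrable (fun g : K → ℝ => C * Real.exp (c * ∑ k, |g k|)) (stdGaussianPi K) := by
  refine Integrable.const_mul ?_ C
  simp_rw [Finset.mul_sum, Real.exp_sum]
  exact Integrable.fintype_prod (f := fun _ s => Real.exp (c * |s|))
    fun _ => integrable_exp_mul_abs_gaussianReal c

lemma ExpGrowth.integrable {ι K : Type*} [Fintype K] {f : ι → (K → ℝ) → ℝ} (hf : ExpGrowth f)
    (i : ι) (hm : Measurable (f i)) : Integrable (f i) (stdGaussianPi K) := by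
  obtain ⟨C, c, -, -, H⟩ := hf
  exact (integrable_exp_mul_sum_abs C c).mono' hm.aestronglyMeasurable
    (ae_of_all _ fun g => H i g)

lemma hasDerivAt_gaussianPDFReal (s : ℝ) :
    HasDerivAt (gaussianPDFReal 0 1) (-s * gaussianPDFReal 0 1 s) s := by
  have h : gaussianPDFReal 0 1 = fun x => (√(2 * π))⁻¹ * Real.exp (-x ^ 2 / 2) := by
    ext x; simp [gaussianPDFReal]
  rw [h]
  have h1 : HasDerivAt (fun x : ℝ => -x ^ 2 / 2) (-s) s := by
    have := ((hasDerivAt_id s).pow 2).neg.div_const 2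
    refine this.congr_deriv ?_
    simp
    ring
  exact (h1.exp.const_mul _).congr_deriv (by ring)

/-- Gaussian integration by parts on the line. -/
lemma integral_mul_gaussianReal {f f' : ℝ → ℝ} (hf : ∀ s, HasDerivAt f (f' s) s)
    (h1 : Integrable f (gaussianReal 0 1)) (h2 : Integrable f' (gaussianReal 0 1))
    (h3 : Integrable (fun s => s * f s) (gaussianReal 0 1)) :
    ∫ s, s * f s ∂(gaussianReal 0 1) = ∫ s, f' s ∂(gaussianReal 0 1) := by
  have key : ∀ h : ℝ → ℝ, Integrable h (gaussianReal 0 1) →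
      Integrable (fun s => gaussianPDFReal 0 1 s * h s) := by
    intro h hh
    rw [gaussianReal_of_var_ne_zero _ one_ne_zero] at hh
    rw [integrable_withDensity_iff_integrable_smul' (measurable_gaussianPDF 0 1)
      (ae_of_all _ fun _ => gaussianPDF_lt_top)] at hh
    simpa [toReal_gaussianPDF] using hh
  rw [integral_gaussianReal_eq_integral_smul one_ne_zero,
    integral_gaussianReal_eq_integral_smul one_ne_zero]
  simp only [smul_eq_mul]
  have := integral_mul_deriv_eq_deriv_mul_of_integrable (u := gaussianPDFReal 0 1)
    (v := f) (u' := fun s => -s * gaussianPDFReal 0 1 s) (v' := f')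
    (fun s _ => hasDerivAt_gaussianPDFReal s) (fun s _ => hf s) (key _ h2)
    (by
      refine (key _ h3).neg.congr (ae_of_all _ fun s => ?_)
      simp; ring) (key _ h1)
  rw [this, ← integral_neg]
  congr 1; ext s; ring

lemma measurePreserving_update {K : Type*} [Fintype K] [DecidableEq K] (k : K) :
    MeasurePreserving (fun q : (K → ℝ) × ℝ => Function.update q.1 k q.2)
      ((stdGaussianPi K).prod (gaussianReal 0 1)) (stdGaussianPi K) := by
  have hm : Measurable (fun q : (K → ℝ) × ℝ => Function.update q.1 k q.2) := by
    refine measurable_pi_lambda _ fun j => ?_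
    by_cases h : j = k
    · subst h; simpa using measurable_snd
    · simp only [Function.update_of_ne h]
      fun_prop
  refine ⟨hm, (Measure.pi_eq fun t ht => ?_).symm⟩
  rw [Measure.map_apply hm (MeasurableSet.univ_pi ht)]
  have : (fun q : (K → ℝ) × ℝ => Function.update q.1 k q.2) ⁻¹' Set.univ.pi t
      = (Set.univ.pi (Function.update t k Set.univ)) ×ˢ t k := by
    ext q
    simp only [Set.mem_preimage, Set.mem_pi, Set.mem_univ, true_imp_iff, Set.mem_prod]
    constructor
    · intro h
      refine ⟨fun j => ?_, by simpa using h k⟩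
      by_cases hj : j = k
      · subst hj; simp
      · simpa [Function.update_of_ne hj] using h j
    · rintro ⟨h, hk⟩ j
      by_cases hj : j = k
      · subst hj; simpa using hk
      · simpa [Function.update_of_ne hj] using h j
  rw [this, Measure.prod_prod, Measure.pi_pi, ← Finset.mul_prod_erase _ _ (Finset.mem_univ k),
    ← Finset.mul_prod_erase _ _ (Finset.mem_univ k)]
  simp only [Function.update_self, measure_univ, one_mul]
  rw [mul_comm]
  congr 1
  refine Finset.prod_congr rfl fun j hj => ?_
  rw [Function.update_of_ne (Finset.ne_of_mem_erase hj)]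

/-- Gaussian integration by parts in the coordinate `k`. -/
lemma integral_coord_mul_stdGaussianPi {K : Type*} [Fintype K] [DecidableEq K] (k : K)
    {H H' : (K → ℝ) → ℝ}
    (hd : ∀ g s, HasDerivAt (fun s => H (Function.update g k s)) (H' (Function.update g k s)) s)
    (hm : Measurable H) (hm' : Measurable H')
    (hH : ExpGrowth fun _ : Unit => H) (hH' : ExpGrowth fun _ : Unit => H') :
    ∫ g, g k * H g ∂(stdGaussianPi K) = ∫ g, H' g ∂(stdGaussianPi K) := by
  have hmp := measurePreserving_update k
  have i1 : Integrable H (stdGaussianPi K) := hH.integrable () hm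
  have i2 : Integrable H' (stdGaussianPi K) := hH'.integrable () hm'
  have i3 : Integrable (fun g => g k * H g) (stdGaussianPi K) :=
    ((ExpGrowth.coord (ι := Unit) k).mul hH).integrable () ((measurable_pi_apply k).mul hm)
  have j1 := hmp.integrable_comp_of_integrable i1
  have j2 := hmp.integrable_comp_of_integrable i2
  have j3 := hmp.integrable_comp_of_integrable i3
  have e2 := hmp.map_eq ▸ integral_map (μ := (stdGaussianPi K).prod (gaussianReal 0 1))
    hmp.measurable.aemeasurable (f := H') (by rw [hmp.map_eq]; exact i2.aestronglyMeasurable)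
  have e3 := hmp.map_eq ▸ integral_map (μ := (stdGaussianPi K).prod (gaussianReal 0 1))
    hmp.measurable.aemeasurable (f := fun g => g k * H g)
    (by rw [hmp.map_eq]; exact i3.aestronglyMeasurable)
  rw [e2, e3]
  refine (integral_prod _ j3).trans (Eq.trans ?_ (integral_prod _ j2).symm)
  refine integral_congr_ae ?_
  filter_upwards [j1.prod_right_ae, j2.prod_right_ae, j3.prod_right_ae] with g a1 a2 a3
  simp only [Function.comp_def, Function.update_self] at a1 a2 a3 ⊢
  exact integral_mul_gaussianReal (hd g) a1 a2 a3

/-- Cameron–Martin density of a shift of the standard Gaussian measure. -/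
def cmDensity {K : Type*} [Fintype K] (v g : K → ℝ) : ℝ :=
  Real.exp (∑ k, v k * g k - (∑ k, v k ^ 2) / 2)

lemma gaussianReal_map_add_eq_withDensity (a : ℝ) :
    (gaussianReal 0 1).map (· + a)
      = (gaussianReal 0 1).withDensity fun s => ENNReal.ofReal (Real.exp (a * s - a ^ 2 / 2)) := by
  rw [gaussianReal_map_add_const, zero_add, gaussianReal_of_var_ne_zero _ one_ne_zero,
    gaussianReal_of_var_ne_zero _ one_ne_zero, ← withDensity_mul _ (measurable_gaussianPDF 0 1)
      (by fun_prop)]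
  congr 1
  ext s
  simp only [gaussianPDF, Pi.mul_apply]
  rw [← ENNReal.ofReal_mul (gaussianPDFReal_nonneg _ _ _)]
  congr 1
  simp only [gaussianPDFReal, NNReal.coe_one, mul_one, sub_zero]
  rw [mul_assoc, ← Real.exp_add]
  congr 2; ring

lemma stdGaussianPi_map_add {K : Type*} [Fintype K] (v : K → ℝ) :
    (stdGaussianPi K).map (· + v)
      = (stdGaussianPi K).withDensity fun g => ENNReal.ofReal (cmDensity v g) := by
  have e : (stdGaussianPi K).map (· + v)
      = Measure.pi fun k => (gaussianReal 0 1).map (· + v k) := by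
    have (k : K) : SigmaFinite ((gaussianReal 0 1).map (· + v k)) := by
      rw [gaussianReal_map_add_const]; infer_instance
    exact Measure.pi_map_pi (μ := fun _ : K => gaussianReal 0 1) (f := fun k s => s + v k)
      (fun k => by fun_prop)
  rw [e]
  have (k : K) : SigmaFinite ((gaussianReal 0 1).map (· + v k)) := by
    rw [gaussianReal_map_add_const]; infer_instance
  refine Measure.pi_eq fun t ht => ?_
  rw [withDensity_apply _ (MeasurableSet.univ_pi ht),
    ← lintegral_indicator (MeasurableSet.univ_pi ht)]
  have h1 : ((Set.univ.pi t).indicator fun g => ENNReal.ofReal (cmDensity v g))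
      = fun g : K → ℝ => ∏ k, (t k).indicator
          (fun s => ENNReal.ofReal (Real.exp (v k * s - v k ^ 2 / 2))) (g k) := by
    ext g
    by_cases hg : g ∈ Set.univ.pi t
    · rw [Set.indicator_of_mem hg]
      have : ∀ k, g k ∈ t k := by simpa using hg
      simp_rw [Set.indicator_of_mem (this _)]
      rw [← ENNReal.ofReal_prod_of_nonneg (fun _ _ => (Real.exp_pos _).le), ← Real.exp_sum,
        Finset.sum_sub_distrib, ← Finset.sum_div]
      rfl
    · rw [Set.indicator_of_notMem hg]
      obtain ⟨k, hk⟩ : ∃ k, g k ∉ t k := by simpa using hg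
      rw [Finset.prod_eq_zero (Finset.mem_univ k)]
      exact Set.indicator_of_notMem hk _
  rw [h1, lintegral_prod_eq_prod_lintegral_of_indepFun Finset.univ
    (fun k (g : K → ℝ) => (t k).indicator
          (fun s => ENNReal.ofReal (Real.exp (v k * s - v k ^ 2 / 2))) (g k))
    (iIndepFun_pi (X := fun k s => (t k).indicator
          (fun s => ENNReal.ofReal (Real.exp (v k * s - v k ^ 2 / 2))) s)
      fun k => ((by fun_prop : Measurable _).indicator (ht k)).aemeasurable)
    fun k => (((by fun_prop : Measurable _).indicator (ht k))).comp (measurable_pi_apply k)]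
  refine Finset.prod_congr rfl fun k _ => ?_
  rw [gaussianReal_map_add_eq_withDensity, withDensity_apply _ (ht k),
    ← lintegral_indicator (ht k)]
  exact (measurePreserving_eval (fun _ : K => gaussianReal 0 1) k).lintegral_comp
    ((by fun_prop : Measurable _).indicator (ht k))


lemma cmDensity_pos {K : Type*} [Fintype K] (v g : K → ℝ) : 0 < cmDensity v g := Real.exp_pos _

@[fun_prop]
lemma continuous_cmDensity {K : Type*} [Fintype K] (v : K → ℝ) : Continuous (cmDensity v) := by
  unfold cmDensity; fun_prop

@[fun_prop]
lemma measurable_cmDensity {K : Type*} [Fintype K] (v : K → ℝ) : Measurable (cmDensity v) :=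
  (continuous_cmDensity v).measurable

lemma integral_comp_add_stdGaussianPi {K : Type*} [Fintype K] (v : K → ℝ) {f : (K → ℝ) → ℝ}
    (hf : Measurable f) :
    ∫ g, f (g + v) ∂(stdGaussianPi K) = ∫ g, cmDensity v g * f g ∂(stdGaussianPi K) := by
  have h := integral_map (μ := stdGaussianPi K) (φ := (· + v)) (by fun_prop)
    (f := f) hf.aestronglyMeasurable
  rw [← h, stdGaussianPi_map_add, integral_withDensity_eq_integral_toReal_smul
    (by fun_prop) (ae_of_all _ fun _ => ENNReal.ofReal_lt_top)]
  simp [ENNReal.toReal_ofReal (cmDensity_pos v _).le]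

lemma integral_cmDensity {K : Type*} [Fintype K] (v : K → ℝ) :
    ∫ g, cmDensity v g ∂(stdGaussianPi K) = 1 := by
  have := integral_comp_add_stdGaussianPi v (f := fun _ => (1 : ℝ)) measurable_const
  simpa using this.symm

/-- Partition function of a Gaussian field with covariance `∑ k, u σ k * u τ k`. -/
def partZ {S K : Type*} [Fintype S] [Fintype K] (w : S → ℝ) (u : S → K → ℝ) (g : K → ℝ) : ℝ :=
  ∑ σ, w σ * cmDensity (u σ) g

/-- A convex function on `(0, ∞)` with its first two derivatives, of moderate growth. -/
structure ModerateConvex (F F' F'' : ℝ → ℝ) : Prop where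
  deriv_one : ∀ z, 0 < z → HasDerivAt F (F' z) z
  deriv_two : ∀ z, 0 < z → HasDerivAt F' (F'' z) z
  nonneg : ∀ z, 0 < z → 0 ≤ F'' z
  measurable_zero : Measurable F
  measurable_one : Measurable F'
  measurable_two : Measurable F''
  growth : ∃ C, 0 ≤ C ∧ ∀ z, 0 < z → |F z| ≤ C * (z + z⁻¹) ^ 2 ∧ |F' z| ≤ C * (z + z⁻¹) ^ 2 ∧
    |F'' z| ≤ C * (z + z⁻¹) ^ 2

section Partition

variable {S K : Type*} [Fintype S] [Fintype K] {w : S → ℝ}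

@[fun_prop]
lemma continuous_partZ (w : S → ℝ) (u : S → K → ℝ) : Continuous (partZ w u) := by
  unfold partZ; fun_prop

@[fun_prop]
lemma measurable_partZ (w : S → ℝ) (u : S → K → ℝ) : Measurable (partZ w u) :=
  (continuous_partZ w u).measurable

lemma partZ_pos (hw : ∀ σ, 0 ≤ w σ) (hW : 0 < ∑ σ, w σ) (u : S → K → ℝ) (g : K → ℝ) :
    0 < partZ w u g := by
  obtain ⟨σ, -, hσ⟩ := Finset.exists_lt_of_sum_lt (f := fun _ => (0 : ℝ)) (by simpa using hW)
  exact Finset.sum_pos' (fun σ _ => mul_nonneg (hw σ) (cmDensity_pos _ _).le)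
    ⟨σ, Finset.mem_univ σ, mul_pos hσ (cmDensity_pos _ _)⟩

lemma abs_sum_mul_le {c : ℝ} {v : K → ℝ} (hv : ∀ k, |v k| ≤ c) (g : K → ℝ) :
    |∑ k, v k * g k| ≤ c * ∑ k, |g k| := by
  rw [Finset.mul_sum]
  refine (Finset.abs_sum_le_sum_abs _ _).trans (Finset.sum_le_sum fun k _ => ?_)
  rw [abs_mul]
  exact mul_le_mul_of_nonneg_right (hv k) (abs_nonneg _)

lemma cmDensity_le {c : ℝ} {v : K → ℝ} (hv : ∀ k, |v k| ≤ c) (g : K → ℝ) :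
    cmDensity v g ≤ Real.exp (c * ∑ k, |g k|) := by
  unfold cmDensity
  have h1 := (abs_le.mp (abs_sum_mul_le hv g)).2
  have h2 : 0 ≤ ∑ k, v k ^ 2 := Finset.sum_nonneg fun _ _ => sq_nonneg _
  gcongr
  linarith

lemma le_cmDensity {c : ℝ} {v : K → ℝ} (hv : ∀ k, |v k| ≤ c) (g : K → ℝ) :
    Real.exp (-(Fintype.card K * c ^ 2 / 2)) * Real.exp (-(c * ∑ k, |g k|)) ≤ cmDensity v g := by
  unfold cmDensity
  have h1 := (abs_le.mp (abs_sum_mul_le hv g)).1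
  have h2 : ∑ k, v k ^ 2 ≤ Fintype.card K * c ^ 2 := by
    calc ∑ k, v k ^ 2 ≤ ∑ _k : K, c ^ 2 :=
          Finset.sum_le_sum fun k _ => sq_le_sq' (neg_le_of_abs_le (hv k)) (le_of_abs_le (hv k))
      _ = _ := by simp
  rw [← Real.exp_add]
  gcongr
  linarith

lemma expGrowth_cmDensity {ι : Type*} {c : ℝ} (hc : 0 ≤ c) {v : ι → K → ℝ}
    (hv : ∀ i k, |v i k| ≤ c) : ExpGrowth fun i => cmDensity (v i) :=
  ⟨1, c, zero_le_one, hc, fun i g => by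
    rw [abs_of_pos (cmDensity_pos _ _), one_mul]; exact cmDensity_le (hv i) g⟩

lemma expGrowth_partZ {ι : Type*} {c : ℝ} (hc : 0 ≤ c) (w : S → ℝ) {u : ι → S → K → ℝ}
    (hu : ∀ i σ k, |u i σ k| ≤ c) : ExpGrowth fun i => partZ w (u i) :=
  ExpGrowth.sum Finset.univ fun σ _ =>
    (expGrowth_cmDensity hc (v := fun i => u i σ) fun i k => hu i σ k).const_mul (w σ)

lemma expGrowth_partZ_inv {ι : Type*} {c : ℝ} (hc : 0 ≤ c) (hw : ∀ σ, 0 ≤ w σ)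
    (hW : 0 < ∑ σ, w σ) {u : ι → S → K → ℝ} (hu : ∀ i σ k, |u i σ k| ≤ c) :
    ExpGrowth fun i g => (partZ w (u i) g)⁻¹ := by
  refine ⟨((∑ σ, w σ) * Real.exp (-(Fintype.card K * c ^ 2 / 2)))⁻¹, c, by positivity, hc,
    fun i g => ?_⟩
  rw [abs_of_pos (inv_pos.2 (partZ_pos hw hW _ _)),
    show Real.exp (c * ∑ k, |g k|) = (Real.exp (-(c * ∑ k, |g k|)))⁻¹ by
      rw [Real.exp_neg, inv_inv], ← mul_inv]
  refine inv_anti₀ (by positivity) ?_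
  rw [mul_assoc, Finset.sum_mul]
  exact Finset.sum_le_sum fun σ _ => mul_le_mul_of_nonneg_left (le_cmDensity (hu i σ) g) (hw σ)

lemma expGrowth_comp_partZ {ι : Type*} {c : ℝ} (hc : 0 ≤ c) (hw : ∀ σ, 0 ≤ w σ)
    (hW : 0 < ∑ σ, w σ) {u : ι → S → K → ℝ} (hu : ∀ i σ k, |u i σ k| ≤ c) {F : ℝ → ℝ} {C : ℝ}
    (hF : ∀ z, 0 < z → |F z| ≤ C * (z + z⁻¹) ^ 2) :
    ExpGrowth fun i g => F (partZ w (u i) g) :=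
  ((((expGrowth_partZ hc w hu).add (expGrowth_partZ_inv hc hw hW hu)).pow 2).const_mul C).mono
    fun _ _ => (hF _ (partZ_pos hw hW _ _)).trans (le_abs_self _)

lemma hasDerivAt_cmDensity_update [DecidableEq K] (v g : K → ℝ) (k : K) (s : ℝ) :
    HasDerivAt (fun s => cmDensity v (Function.update g k s))
      (v k * cmDensity v (Function.update g k s)) s := by
  have h : ∀ s, ∑ j, v j * Function.update g k s j
      = v k * s + ∑ j ∈ Finset.univ.erase k, v j * g j := by
    intro s
    rw [← Finset.add_sum_erase _ _ (Finset.mem_univ k), Function.update_self]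
    congr 1
    exact Finset.sum_congr rfl fun j hj => by rw [Function.update_of_ne (Finset.ne_of_mem_erase hj)]
  simp only [cmDensity, h]
  have := ((((hasDerivAt_id s).const_mul (v k)).add_const
    (∑ j ∈ Finset.univ.erase k, v j * g j)).sub_const ((∑ k, v k ^ 2) / 2)).exp
  exact this.congr_deriv (by simp [mul_comm])

lemma hasDerivAt_partZ_update [DecidableEq K] (w : S → ℝ) (u : S → K → ℝ) (g : K → ℝ) (k : K)
    (s : ℝ) :
    HasDerivAt (fun s => partZ w u (Function.update g k s))
      (∑ σ, w σ * (u σ k * cmDensity (u σ) (Function.update g k s))) s := by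
  unfold partZ
  exact HasDerivAt.fun_sum fun σ _ => (hasDerivAt_cmDensity_update (u σ) g k s).const_mul (w σ)

lemma hasDerivAt_cmDensity_curve {v v' : ℝ → K → ℝ} {t : ℝ}
    (hv : ∀ k, HasDerivAt (fun t => v t k) (v' t k) t) (g : K → ℝ) :
    HasDerivAt (fun t => cmDensity (v t) g)
      (cmDensity (v t) g * ∑ k, v' t k * (g k - v t k)) t := by
  have h1 : HasDerivAt (fun t => ∑ k, v t k * g k) (∑ k, v' t k * g k) t :=
    HasDerivAt.fun_sum fun k _ => (hv k).mul_const (g k)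
  have h2 : HasDerivAt (fun t => ∑ k, v t k ^ 2) (∑ k, 2 * v t k * v' t k) t :=
    HasDerivAt.fun_sum fun k _ => ((hv k).pow 2).congr_deriv (by simp)
  refine ((h1.sub (h2.div_const 2)).exp).congr_deriv ?_
  unfold cmDensity
  congr 1
  rw [Finset.sum_div, ← Finset.sum_sub_distrib]
  exact Finset.sum_congr rfl fun k _ => by ring

lemma hasDerivAt_partZ_curve (w : S → ℝ) {u u' : ℝ → S → K → ℝ} {t : ℝ}
    (hu : ∀ σ k, HasDerivAt (fun t => u t σ k) (u' t σ k) t) (g : K → ℝ) :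
    HasDerivAt (fun t => partZ w (u t) g)
      (∑ σ, w σ * (cmDensity (u t σ) g * ∑ k, u' t σ k * (g k - u t σ k))) t := by
  unfold partZ
  exact HasDerivAt.fun_sum fun σ _ =>
    (hasDerivAt_cmDensity_curve (v := fun t => u t σ) (v' := fun t => u' t σ) (hu σ) g).const_mul
      (w σ)

variable {F F' F'' : ℝ → ℝ}

lemma integral_coord_mul_comp_partZ (hF : ModerateConvex F F' F'') (hw : ∀ σ, 0 ≤ w σ)
    (hW : 0 < ∑ σ, w σ) (u : S → K → ℝ) (σ : S) (k : K) :
    ∫ g, (g k - u σ k) * (F' (partZ w u g) * cmDensity (u σ) g) ∂(stdGaussianPi K)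
      = ∫ g, F'' (partZ w u g) * (∑ τ, w τ * (u τ k * cmDensity (u τ) g)) * cmDensity (u σ) g
          ∂(stdGaussianPi K) := by
  classical
  obtain ⟨C, hC, hbd⟩ := hF.growth
  have mF := hF.measurable_zero
  have mF' := hF.measurable_one
  have mF'' := hF.measurable_two
  obtain ⟨c, hc, hcu⟩ : ∃ c, 0 ≤ c ∧ ∀ τ j, |u τ j| ≤ c := by
    refine ⟨∑ τ, ∑ j, |u τ j|, by positivity, fun τ j => ?_⟩
    exact (Finset.single_le_sum (f := fun j => |u τ j|) (fun _ _ => abs_nonneg _)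
      (Finset.mem_univ j)).trans (Finset.single_le_sum (f := fun τ => ∑ j, |u τ j|)
        (fun _ _ => by positivity) (Finset.mem_univ τ))
  have g1 : ExpGrowth fun (_ : Unit) g => F' (partZ w u g) :=
    expGrowth_comp_partZ hc hw hW (u := fun _ => u) (fun _ => hcu) fun z hz => (hbd z hz).2.1
  have g2 : ExpGrowth fun (_ : Unit) g => F'' (partZ w u g) :=
    expGrowth_comp_partZ hc hw hW (u := fun _ => u) (fun _ => hcu) fun z hz => (hbd z hz).2.2
  have g3 : ∀ τ, ExpGrowth fun (_ : Unit) g => cmDensity (u τ) g := fun τ =>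
    expGrowth_cmDensity hc (v := fun _ => u τ) fun _ => hcu τ
  have m1 : Measurable fun g => F' (partZ w u g) := hF.measurable_one.comp (measurable_partZ w u)
  have m2 : Measurable fun g => F'' (partZ w u g) := hF.measurable_two.comp (measurable_partZ w u)
  have gS : ExpGrowth fun (_ : Unit) g => ∑ τ, w τ * (u τ k * cmDensity (u τ) g) :=
    ExpGrowth.sum Finset.univ fun τ _ => ((g3 τ).const_mul (u τ k)).const_mul (w τ)
  have gA := (g2.mul gS).mul (g3 σ)
  have gB := (g1.mul (g3 σ)).const_mul (u σ k)
  have mA : Measurable fun g => F'' (partZ w u g) * (∑ τ, w τ * (u τ k * cmDensity (u τ) g)) *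
      cmDensity (u σ) g := by fun_prop
  have mB : Measurable fun g => u σ k * (F' (partZ w u g) * cmDensity (u σ) g) := by fun_prop
  have key := integral_coord_mul_stdGaussianPi k
    (H := fun g => F' (partZ w u g) * cmDensity (u σ) g)
    (H' := fun g => F'' (partZ w u g) * (∑ τ, w τ * (u τ k * cmDensity (u τ) g)) *
      cmDensity (u σ) g + u σ k * (F' (partZ w u g) * cmDensity (u σ) g))
    (fun g s => by
      refine (((hF.deriv_two _ (partZ_pos hw hW u _)).comp s
        (hasDerivAt_partZ_update w u g k s)).mul
          (hasDerivAt_cmDensity_update (u σ) g k s)).congr_deriv ?_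
      simp only [Function.comp_apply]
      ring)
    (by fun_prop) (mA.add mB) (g1.mul (g3 σ)) (gA.add gB)
  have i1 := ((ExpGrowth.coord k).mul (g1.mul (g3 σ))).integrable () (by fun_prop)
  have iA := gA.integrable () mA
  have iB := gB.integrable () mB
  rw [integral_add iA iB] at key
  simp only [sub_mul]
  rw [integral_sub i1 iB, key]
  ring

/-- Derivative of `E F(Z)` along a curve of Gaussian fields. -/
lemma hasDerivAt_integral_comp_partZ (hF : ModerateConvex F F' F'') (hw : ∀ σ, 0 ≤ w σ)
    (hW : 0 < ∑ σ, w σ) {u u' : ℝ → S → K → ℝ} {c : ℝ} (hc : 0 ≤ c)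
    (hu : ∀ t σ k, HasDerivAt (fun t => u t σ k) (u' t σ k) t)
    (huc : ∀ t σ k, |u t σ k| ≤ c) (huc' : ∀ t σ k, |u' t σ k| ≤ c) (t : ℝ) :
    HasDerivAt (fun t => ∫ g, F (partZ w (u t) g) ∂(stdGaussianPi K))
      (∫ g, F'' (partZ w (u t) g) * ∑ σ, ∑ τ, w σ * cmDensity (u t σ) g *
        (w τ * cmDensity (u t τ) g) * ∑ k, u' t σ k * u t τ k ∂(stdGaussianPi K)) t := by
  obtain ⟨C, hC, hbd⟩ := hF.growth
  have mF := hF.measurable_zero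
  have mF' := hF.measurable_one
  have mF'' := hF.measurable_two
  have g0 : ExpGrowth fun t g => F (partZ w (u t) g) :=
    expGrowth_comp_partZ hc hw hW huc fun z hz => (hbd z hz).1
  have g1 : ExpGrowth fun t g => F' (partZ w (u t) g) :=
    expGrowth_comp_partZ hc hw hW huc fun z hz => (hbd z hz).2.1
  have g2 : ExpGrowth fun t g => F'' (partZ w (u t) g) :=
    expGrowth_comp_partZ hc hw hW huc fun z hz => (hbd z hz).2.2
  have g3 : ∀ τ, ExpGrowth fun t g => cmDensity (u t τ) g := fun τ =>
    expGrowth_cmDensity hc fun t => huc t τ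
  have m0 : ∀ t, Measurable fun g => F (partZ w (u t) g) :=
    fun t => hF.measurable_zero.comp (measurable_partZ w _)
  have m1 : ∀ t, Measurable fun g => F' (partZ w (u t) g) :=
    fun t => hF.measurable_one.comp (measurable_partZ w _)
  have m2 : ∀ t, Measurable fun g => F'' (partZ w (u t) g) :=
    fun t => hF.measurable_two.comp (measurable_partZ w _)
  have gu : ∀ σ k, ExpGrowth (K := K) fun t _ => u t σ k :=
    fun σ k => ExpGrowth.of_bounded fun t _ => huc t σ k
  have gu' : ∀ σ k, ExpGrowth (K := K) fun t _ => u' t σ k :=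
    fun σ k => ExpGrowth.of_bounded fun t _ => huc' t σ k
  have gD : ExpGrowth fun t g => F' (partZ w (u t) g) *
      ∑ σ, w σ * (cmDensity (u t σ) g * ∑ k, u' t σ k * (g k - u t σ k)) :=
    g1.mul (ExpGrowth.sum _ fun σ _ => ((g3 σ).mul (ExpGrowth.sum _ fun k _ =>
      (gu' σ k).mul ((ExpGrowth.coord k).sub (gu σ k)))).const_mul (w σ))
  have mD : ∀ t, Measurable fun g => F' (partZ w (u t) g) *
      ∑ σ, w σ * (cmDensity (u t σ) g * ∑ k, u' t σ k * (g k - u t σ k)) :=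
    fun t => by fun_prop
  obtain ⟨CD, cD, -, -, hD⟩ := gD
  have main := (hasDerivAt_integral_of_dominated_loc_of_deriv_le (μ := stdGaussianPi K)
    (F := fun t g => F (partZ w (u t) g)) (x₀ := t) univ_mem
    (Eventually.of_forall fun t => (m0 t).aestronglyMeasurable) (g0.integrable t (m0 t))
    (mD t).aestronglyMeasurable (ae_of_all _ fun g t _ => hD t g)
    (integrable_exp_mul_sum_abs CD cD)
    (ae_of_all _ fun g t _ => (hF.deriv_one _ (partZ_pos hw hW _ _)).comp t
      (hasDerivAt_partZ_curve w (hu t) g))).2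
  refine main.congr_deriv ?_
  have gI : ∀ σ k, ExpGrowth fun t g => (g k - u t σ k) * (F' (partZ w (u t) g) *
      cmDensity (u t σ) g) := fun σ k => ((ExpGrowth.coord k).sub (gu σ k)).mul (g1.mul (g3 σ))
  have gJ : ∀ σ k, ExpGrowth fun t g => F'' (partZ w (u t) g) *
      (∑ τ, w τ * (u t τ k * cmDensity (u t τ) g)) * cmDensity (u t σ) g := fun σ k =>
    (g2.mul (ExpGrowth.sum _ fun τ _ => ((gu τ k).mul (g3 τ)).const_mul (w τ))).mul (g3 σ)
  calc _ = ∫ g, ∑ σ, ∑ k, (w σ * u' t σ k) * ((g k - u t σ k) * (F' (partZ w (u t) g) *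
        cmDensity (u t σ) g)) ∂(stdGaussianPi K) := by
        congr 1; ext g
        simp only [Finset.mul_sum]
        exact Finset.sum_congr rfl fun σ _ => Finset.sum_congr rfl fun k _ => by ring
    _ = ∑ σ, ∑ k, (w σ * u' t σ k) * ∫ g, (g k - u t σ k) * (F' (partZ w (u t) g) *
        cmDensity (u t σ) g) ∂(stdGaussianPi K) := by
        rw [integral_finsetSum _ fun σ _ => integrable_finsetSum _ fun k _ =>
          ((gI σ k).integrable t (by fun_prop)).const_mul _]
        refine Finset.sum_congr rfl fun σ _ => ?_
        rw [integral_finsetSum _ fun k _ => ((gI σ k).integrable t (by fun_prop)).const_mul _]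
        exact Finset.sum_congr rfl fun k _ => integral_const_mul _ _
    _ = ∑ σ, ∑ k, (w σ * u' t σ k) * ∫ g, F'' (partZ w (u t) g) *
        (∑ τ, w τ * (u t τ k * cmDensity (u t τ) g)) * cmDensity (u t σ) g
          ∂(stdGaussianPi K) := by
        simp only [integral_coord_mul_comp_partZ hF hw hW]
    _ = ∫ g, ∑ σ, ∑ k, (w σ * u' t σ k) * (F'' (partZ w (u t) g) *
        (∑ τ, w τ * (u t τ k * cmDensity (u t τ) g)) * cmDensity (u t σ) g)
          ∂(stdGaussianPi K) := by
        rw [integral_finsetSum _ fun σ _ => integrable_finsetSum _ fun k _ =>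
          ((gJ σ k).integrable t (by fun_prop)).const_mul _]
        refine Finset.sum_congr rfl fun σ _ => ?_
        rw [integral_finsetSum _ fun k _ => ((gJ σ k).integrable t (by fun_prop)).const_mul _]
        exact Finset.sum_congr rfl fun k _ => (integral_const_mul _ _).symm
    _ = _ := by
        congr 1; ext g
        simp only [Finset.mul_sum, Finset.sum_mul]
        refine Finset.sum_congr rfl fun σ _ => ?_
        rw [Finset.sum_comm]
        exact Finset.sum_congr rfl fun τ _ => Finset.sum_congr rfl fun k _ => by ring

end Partition

section Comparison

variable {S K L : Type*} [Fintype S] [Fintype K] [Fintype L] {w : S → ℝ}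

lemma integral_comp_inl_stdGaussianPi {f : (K → ℝ) → ℝ} (hf : Measurable f) :
    ∫ g, f (fun k => g (.inl k)) ∂(stdGaussianPi (K ⊕ L)) = ∫ g, f g ∂(stdGaussianPi K) := by
  have h := (measurePreserving_fst (μ := stdGaussianPi K) (ν := stdGaussianPi L)).comp
    (measurePreserving_sumPiEquivProdPi (X := fun _ : K ⊕ L => ℝ) fun _ => gaussianReal 0 1)
  exact (h.map_eq ▸ integral_map (f := f) h.measurable.aemeasurable
    hf.aestronglyMeasurable).symm

lemma integral_comp_inr_stdGaussianPi {f : (L → ℝ) → ℝ} (hf : Measurable f) :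
    ∫ g, f (fun k => g (.inr k)) ∂(stdGaussianPi (K ⊕ L)) = ∫ g, f g ∂(stdGaussianPi L) := by
  have h := (measurePreserving_snd (μ := stdGaussianPi K) (ν := stdGaussianPi L)).comp
    (measurePreserving_sumPiEquivProdPi (X := fun _ : K ⊕ L => ℝ) fun _ => gaussianReal 0 1)
  exact (h.map_eq ▸ integral_map (f := f) h.measurable.aemeasurable
    hf.aestronglyMeasurable).symm

variable {F F' F'' : ℝ → ℝ}

/-- Kahane's convexity inequality, up to an additive constant on the covariances. -/
theorem kahane_comparison (hF : ModerateConvex F F' F'') (hw : ∀ σ, 0 ≤ w σ)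
    (hW : 0 < ∑ σ, w σ) (a : S → K → ℝ) (b : S → L → ℝ) {c κ : ℝ}
    (hκ : ∀ u : S → (K ⊕ L) → ℝ,
      ∫ g, F'' (partZ w u g) * partZ w u g ^ 2 ∂(stdGaussianPi (K ⊕ L)) = κ)
    (hab : ∀ σ τ, ∑ l, b σ l * b τ l ≤ ∑ k, a σ k * a τ k + c) :
    ∫ g, F (partZ w b g) ∂(stdGaussianPi L) ≤
      ∫ g, F (partZ w a g) ∂(stdGaussianPi K) + κ * c / 2 := by
  have mF := hF.measurable_zero
  have mF'' := hF.measurable_two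
  obtain ⟨C, hC, hbd⟩ := hF.growth
  set u : ℝ → S → (K ⊕ L) → ℝ := fun t σ =>
    Sum.elim (fun k => Real.sin t * a σ k) (fun l => Real.cos t * b σ l) with hu
  set u' : ℝ → S → (K ⊕ L) → ℝ := fun t σ =>
    Sum.elim (fun k => Real.cos t * a σ k) (fun l => -Real.sin t * b σ l) with hu'
  set R : ℝ := ∑ σ, (∑ k, |a σ k| + ∑ l, |b σ l|) with hR
  have hR0 : 0 ≤ R := by positivity
  have hRa : ∀ σ k, |a σ k| ≤ R := fun σ k =>
    ((Finset.single_le_sum (f := fun k => |a σ k|) (fun _ _ => abs_nonneg _)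
      (Finset.mem_univ k)).trans (le_add_of_nonneg_right (by positivity))).trans
      (Finset.single_le_sum (f := fun σ => ∑ k, |a σ k| + ∑ l, |b σ l|)
        (fun _ _ => by positivity) (Finset.mem_univ σ))
  have hRb : ∀ σ l, |b σ l| ≤ R := fun σ l =>
    ((Finset.single_le_sum (f := fun k => |b σ k|) (fun _ _ => abs_nonneg _)
      (Finset.mem_univ l)).trans (le_add_of_nonneg_left (by positivity))).trans
      (Finset.single_le_sum (f := fun σ => ∑ k, |a σ k| + ∑ l, |b σ l|)
        (fun _ _ => by positivity) (Finset.mem_univ σ))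
  have bound : ∀ {x y : ℝ}, |x| ≤ 1 → |y| ≤ R → |x * y| ≤ R := fun hx hy => by
    rw [abs_mul]
    exact (mul_le_mul hx hy (abs_nonneg _) zero_le_one).trans (one_mul R).le
  have huR : ∀ t σ k, |u t σ k| ≤ R := by
    rintro t σ (k | l)
    · exact bound (Real.abs_sin_le_one t) (hRa σ k)
    · exact bound (Real.abs_cos_le_one t) (hRb σ l)
  have huR' : ∀ t σ k, |u' t σ k| ≤ R := by
    rintro t σ (k | l)
    · exact bound (Real.abs_cos_le_one t) (hRa σ k)
    · exact bound (by simpa using Real.abs_sin_le_one t) (hRb σ l)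
  have hud : ∀ t σ k, HasDerivAt (fun t => u t σ k) (u' t σ k) t := by
    rintro t σ (k | l)
    · exact (Real.hasDerivAt_sin t).mul_const _
    · exact (Real.hasDerivAt_cos t).mul_const _
  have hD : ∀ t σ τ, ∑ k, u' t σ k * u t τ k
      = Real.sin t * Real.cos t * (∑ k, a σ k * a τ k - ∑ l, b σ l * b τ l) := by
    intro t σ τ
    simp only [hu, hu', Fintype.sum_sum_type, Sum.elim_inl, Sum.elim_inr]
    rw [mul_sub, Finset.mul_sum, Finset.mul_sum, sub_eq_add_neg, ← Finset.sum_neg_distrib]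
    congr 1 <;> exact Finset.sum_congr rfl fun _ _ => by ring
  set φ : ℝ → ℝ := fun t => ∫ g, F (partZ w (u t) g) ∂(stdGaussianPi (K ⊕ L)) with hφ
  have hφd := hasDerivAt_integral_comp_partZ hF hw hW hR0 hud huR huR'
  have hsin : ∀ t, HasDerivAt (fun t => κ * c / 2 * Real.sin t ^ 2)
      (κ * (c * (Real.sin t * Real.cos t))) t := fun t =>
    (((Real.hasDerivAt_sin t).pow 2).const_mul (κ * c / 2)).congr_deriv (by simp; ring)
  have hmono : MonotoneOn (fun t => φ t + κ * c / 2 * Real.sin t ^ 2) (Set.Icc 0 (π / 2)) := by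
    refine monotoneOn_of_deriv_nonneg (convex_Icc _ _)
      (fun t _ => ((hφd t).add (hsin t)).continuousAt.continuousWithinAt)
      (fun t _ => ((hφd t).add (hsin t)).differentiableAt.differentiableWithinAt) fun t ht => ?_
    rw [interior_Icc] at ht
    rw [HasDerivAt.deriv (f := fun t => φ t + κ * c / 2 * Real.sin t ^ 2)
      ((hφd t).add (hsin t))]
    have hs : 0 ≤ Real.sin t * Real.cos t :=
      mul_nonneg (Real.sin_nonneg_of_nonneg_of_le_pi ht.1.le (by linarith [ht.2, Real.pi_pos]))
        (Real.cos_nonneg_of_neg_pi_div_two_le_of_le (by linarith [ht.1, Real.pi_pos]) ht.2.le)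
    have g2 : ExpGrowth fun t g => F'' (partZ w (u t) g) :=
      expGrowth_comp_partZ hR0 hw hW huR fun z hz => (hbd z hz).2.2
    have g3 : ∀ τ, ExpGrowth fun t g => cmDensity (u t τ) g := fun τ =>
      expGrowth_cmDensity hR0 fun t => huR t τ
    have i1 : Integrable (fun g => F'' (partZ w (u t) g) * ∑ σ, ∑ τ, w σ * cmDensity (u t σ) g *
        (w τ * cmDensity (u t τ) g) * ∑ k, u' t σ k * u t τ k) (stdGaussianPi (K ⊕ L)) :=
      (g2.mul (ExpGrowth.sum _ fun σ _ => ExpGrowth.sum _ fun τ _ =>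
        (((g3 σ).const_mul (w σ)).mul ((g3 τ).const_mul (w τ))).mul
          (ExpGrowth.sum _ fun k _ =>
            (ExpGrowth.of_bounded fun t _ => huR' t σ k).mul
              (ExpGrowth.of_bounded fun t _ => huR t τ k)))).integrable t (by fun_prop)
    have i2 : Integrable (fun g => F'' (partZ w (u t) g) * partZ w (u t) g ^ 2)
        (stdGaussianPi (K ⊕ L)) :=
      (g2.mul ((expGrowth_partZ hR0 w huR).pow 2)).integrable t (by fun_prop)
    rw [← hκ (u t), ← integral_mul_const, ← integral_add i1 (i2.mul_const _)]
    refine integral_nonneg fun g => ?_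
    simp only [Pi.zero_apply]
    have e : F'' (partZ w (u t) g) * ∑ σ, ∑ τ, w σ * cmDensity (u t σ) g *
        (w τ * cmDensity (u t τ) g) * ∑ k, u' t σ k * u t τ k
        + F'' (partZ w (u t) g) * partZ w (u t) g ^ 2 * (c * (Real.sin t * Real.cos t))
        = F'' (partZ w (u t) g) * ∑ σ, ∑ τ, w σ * cmDensity (u t σ) g *
        (w τ * cmDensity (u t τ) g) * (∑ k, u' t σ k * u t τ k + c * (Real.sin t * Real.cos t)) := by
      simp only [mul_add, Finset.sum_add_distrib]
      congr 1
      rw [mul_assoc]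
      congr 1
      simp only [← Finset.sum_mul]
      congr 1
      rw [sq, partZ, Finset.sum_mul_sum]
    rw [e]
    refine mul_nonneg (hF.nonneg _ (partZ_pos hw hW _ _)) (Finset.sum_nonneg fun σ _ =>
      Finset.sum_nonneg fun τ _ => mul_nonneg (mul_nonneg
        (mul_nonneg (hw σ) (cmDensity_pos _ _).le) (mul_nonneg (hw τ) (cmDensity_pos _ _).le)) ?_)
    rw [hD, mul_comm c, ← mul_add]
    exact mul_nonneg hs (by linarith [hab σ τ])
  have h := hmono (Set.left_mem_Icc.2 (by positivity)) (Set.right_mem_Icc.2 (by positivity))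
    (by positivity : (0 : ℝ) ≤ π / 2)
  have e0 : φ 0 = ∫ g, F (partZ w b g) ∂(stdGaussianPi L) := by
    rw [← integral_comp_inr_stdGaussianPi (K := K) (f := fun g => F (partZ w b g)) (by fun_prop)]
    simp [hφ, hu, partZ, cmDensity, Fintype.sum_sum_type]
  have e1 : φ (π / 2) = ∫ g, F (partZ w a g) ∂(stdGaussianPi K) := by
    rw [← integral_comp_inl_stdGaussianPi (L := L) (f := fun g => F (partZ w a g)) (by fun_prop)]
    simp [hφ, hu, partZ, cmDensity, Fintype.sum_sum_type]
  simpa [e0, e1] using h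

lemma one_le_add_inv_sq {z : ℝ} (hz : 0 < z) : z + z⁻¹ ≤ (z + z⁻¹) ^ 2 ∧ 1 ≤ z + z⁻¹ := by
  have h1 : 1 ≤ z + z⁻¹ := by
    rcases le_total 1 z with h | h
    · linarith [inv_pos.2 hz]
    · linarith [(one_le_inv₀ hz).2 h]
  exact ⟨by nlinarith, h1⟩

lemma abs_log_le_add_inv {z : ℝ} (hz : 0 < z) : |Real.log z| ≤ z + z⁻¹ := by
  rw [abs_le]
  have h1 := Real.log_le_sub_one_of_pos hz
  have h2 := Real.log_le_sub_one_of_pos (inv_pos.2 hz)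
  rw [Real.log_inv] at h2
  constructor <;> linarith [inv_pos.2 hz]

lemma moderateConvex_neg_log :
    ModerateConvex (fun z => -Real.log z) (fun z => -z⁻¹) (fun z => (z ^ 2)⁻¹) where
  deriv_one z hz := (Real.hasDerivAt_log hz.ne').neg
  deriv_two z hz := (hasDerivAt_inv hz.ne').neg.congr_deriv (by simp)
  nonneg z hz := by positivity
  measurable_zero := by fun_prop
  measurable_one := by fun_prop
  measurable_two := by fun_prop
  growth := by
    refine ⟨1, zero_le_one, fun z hz => ?_⟩
    obtain ⟨h1, h2⟩ := one_le_add_inv_sq hz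
    have h3 := inv_pos.2 hz
    refine ⟨?_, ?_, ?_⟩
    · rw [abs_neg]; linarith [abs_log_le_add_inv hz]
    · rw [abs_neg, abs_of_pos h3]; linarith
    · rw [abs_of_pos (by positivity), ← inv_pow]; nlinarith

lemma moderateConvex_mul_log :
    ModerateConvex (fun z => z * Real.log z) (fun z => Real.log z + 1) (fun z => z⁻¹) where
  deriv_one z hz := Real.hasDerivAt_mul_log hz.ne'
  deriv_two z hz := (Real.hasDerivAt_log hz.ne').add_const 1
  nonneg z hz := by positivity
  measurable_zero := by fun_prop
  measurable_one := by fun_prop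
  measurable_two := by fun_prop
  growth := by
    refine ⟨2, zero_le_two, fun z hz => ?_⟩
    obtain ⟨h1, h2⟩ := one_le_add_inv_sq hz
    have h3 := inv_pos.2 hz
    have h4 := abs_log_le_add_inv hz
    refine ⟨?_, ?_, ?_⟩
    · rw [abs_mul, abs_of_pos hz]
      nlinarith [mul_le_mul_of_nonneg_left h4 hz.le]
    · calc _ ≤ |Real.log z| + |1| := abs_add_le _ _
        _ ≤ _ := by rw [abs_one]; linarith
    · rw [abs_of_pos h3]; linarith

lemma integrable_cmDensity (v : K → ℝ) : Integrable (cmDensity v) (stdGaussianPi K) :=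
  (expGrowth_cmDensity (ι := Unit) (c := ∑ k, |v k|) (by positivity) (v := fun _ => v)
    fun _ k => Finset.single_le_sum (f := fun k => |v k|) (fun _ _ => abs_nonneg _)
      (Finset.mem_univ k)).integrable () (by fun_prop)

lemma integral_partZ (w : S → ℝ) (u : S → K → ℝ) :
    ∫ g, partZ w u g ∂(stdGaussianPi K) = ∑ σ, w σ := by
  unfold partZ
  rw [integral_finsetSum _ fun σ _ => (integrable_cmDensity (u σ)).const_mul _]
  simp [integral_const_mul, integral_cmDensity]

/-- Comparison of quenched free energies. -/
theorem integral_log_partZ_le (hw : ∀ σ, 0 ≤ w σ) (hW : 0 < ∑ σ, w σ) (a : S → K → ℝ)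
    (b : S → L → ℝ) {c : ℝ} (hab : ∀ σ τ, ∑ l, b σ l * b τ l ≤ ∑ k, a σ k * a τ k + c) :
    ∫ g, Real.log (partZ w a g) ∂(stdGaussianPi K) ≤
      ∫ g, Real.log (partZ w b g) ∂(stdGaussianPi L) + c / 2 := by
  have := kahane_comparison moderateConvex_neg_log hw hW a b (κ := 1) (fun u => by
    have : ∀ g, (partZ w u g ^ 2)⁻¹ * partZ w u g ^ 2 = 1 := fun g =>
      inv_mul_cancel₀ (pow_pos (partZ_pos hw hW u g) 2).ne'
    simp [this]) hab
  simp only [integral_neg] at this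
  linarith

/-- Comparison of entropies. -/
theorem integral_mul_log_partZ_le (hw : ∀ σ, 0 ≤ w σ) (hW : ∑ σ, w σ = 1) (a : S → K → ℝ)
    (b : S → L → ℝ) {c : ℝ} (hab : ∀ σ τ, ∑ l, b σ l * b τ l ≤ ∑ k, a σ k * a τ k + c) :
    ∫ g, partZ w b g * Real.log (partZ w b g) ∂(stdGaussianPi L) ≤
      ∫ g, partZ w a g * Real.log (partZ w a g) ∂(stdGaussianPi K) + c / 2 := by
  have hW' : 0 < ∑ σ, w σ := hW ▸ one_pos
  have := kahane_comparison moderateConvex_mul_log hw hW' a b (κ := 1) (fun u => by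
    have : ∀ g, (partZ w u g)⁻¹ * partZ w u g ^ 2 = partZ w u g := fun g => by
      have := (partZ_pos hw hW' u g).ne'
      field_simp
    simp only [this, integral_partZ, hW]) hab
  linarith

lemma integrable_comp_partZ {F F' F'' : ℝ → ℝ} (hF : ModerateConvex F F' F'')
    (hw : ∀ σ, 0 ≤ w σ) (hW : 0 < ∑ σ, w σ) (u : S → K → ℝ) :
    Integrable (fun g => F (partZ w u g)) (stdGaussianPi K) := by
  obtain ⟨C, hC, hbd⟩ := hF.growth
  refine (expGrowth_comp_partZ (ι := Unit) (c := ∑ σ, ∑ k, |u σ k|) (by positivity) hw hW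
    (u := fun _ => u) (fun _ τ j => ?_) fun z hz => (hbd z hz).1).integrable ()
    (hF.measurable_zero.comp (by fun_prop))
  exact (Finset.single_le_sum (f := fun j => |u τ j|) (fun _ _ => abs_nonneg _)
      (Finset.mem_univ j)).trans (Finset.single_le_sum (f := fun τ => ∑ j, |u τ j|)
        (fun _ _ => by positivity) (Finset.mem_univ τ))

/-- The entropy of the partition function is its planted free energy. -/
theorem integral_mul_log_partZ (hw : ∀ σ, 0 ≤ w σ) (hW : 0 < ∑ σ, w σ) (u : S → K → ℝ) :
    ∫ g, partZ w u g * Real.log (partZ w u g) ∂(stdGaussianPi K) =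
      ∑ σ, w σ * ∫ g, Real.log (partZ w u (g + u σ)) ∂(stdGaussianPi K) := by
  have hi : ∀ σ, Integrable (fun g => cmDensity (u σ) g * Real.log (partZ w u g))
      (stdGaussianPi K) := fun σ => by
    have h := (expGrowth_cmDensity (ι := Unit) (c := ∑ σ, ∑ k, |u σ k|) (by positivity)
      (v := fun _ => u σ) fun _ j => (Finset.single_le_sum (f := fun j => |u σ j|)
        (fun _ _ => abs_nonneg _) (Finset.mem_univ j)).trans (Finset.single_le_sum
          (f := fun τ => ∑ j, |u τ j|) (fun _ _ => by positivity) (Finset.mem_univ σ)))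
    obtain ⟨C, hC, hbd⟩ := moderateConvex_neg_log.growth
    refine (h.mul (expGrowth_comp_partZ (F := Real.log) (c := ∑ σ, ∑ k, |u σ k|) (by positivity)
      hw hW (u := fun _ => u) (fun _ τ j => ?_)
      fun z hz => by simpa using (hbd z hz).1)).integrable () (by fun_prop)
    exact (Finset.single_le_sum (f := fun j => |u τ j|) (fun _ _ => abs_nonneg _)
      (Finset.mem_univ j)).trans (Finset.single_le_sum (f := fun τ => ∑ j, |u τ j|)
        (fun _ _ => by positivity) (Finset.mem_univ τ))
  have e : ∀ g, partZ w u g * Real.log (partZ w u g)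
      = ∑ σ, w σ * (cmDensity (u σ) g * Real.log (partZ w u g)) := fun g => by
    conv_lhs => rw [partZ]
    rw [Finset.sum_mul]
    exact Finset.sum_congr rfl fun σ _ => by rw [mul_assoc, partZ]
  simp only [e]
  rw [integral_finsetSum _ fun σ _ => (hi σ).const_mul _]
  refine Finset.sum_congr rfl fun σ _ => ?_
  rw [integral_const_mul, ← integral_comp_add_stdGaussianPi (u σ)
    (f := fun g => Real.log (partZ w u g)) (by fun_prop)]

end Comparison

section KLDivergence

variable {α β α' β' : Type*} [MeasurableSpace α] [MeasurableSpace β] [MeasurableSpace α']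
  [MeasurableSpace β']

lemma klDivR_map {e : α → β} (he : MeasurableEmbedding e) {μ ν : Measure α} [SigmaFinite μ]
    [SigmaFinite ν] (hμν : μ ≪ ν) : klDivR (μ.map e) (ν.map e) = klDivR μ ν := by
  rw [klDivR, klDivR, he.integral_map]
  refine integral_congr_ae ?_
  filter_upwards [hμν.ae_le (he.rnDeriv_map μ ν)] with a ha
  simp only [llr, ha]

lemma mutualInfoR_map_prodMap {f : α → α'} {h : β → β'} (hf : MeasurableEmbedding f)
    (hh : MeasurableEmbedding h) {μ : Measure (α × β)} [IsProbabilityMeasure μ]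
    (hμ : μ ≪ μ.fst.prod μ.snd) :
    mutualInfoR (μ.map (Prod.map f h)) = mutualInfoR μ := by
  have h1 : (μ.map (Prod.map f h)).fst = μ.fst.map f := by
    rw [Measure.fst, Measure.fst, Measure.map_map measurable_fst
      (by fun_prop (disch := exact hf.measurable)),
      Measure.map_map hf.measurable measurable_fst]
    rfl
  have h2 : (μ.map (Prod.map f h)).snd = μ.snd.map h := by
    rw [Measure.snd, Measure.snd, Measure.map_map measurable_snd
      (hf.measurable.prodMap hh.measurable),
      Measure.map_map hh.measurable measurable_snd]
    rfl
  have : IsProbabilityMeasure (μ.snd.map h) :=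
    Measure.isProbabilityMeasure_map hh.measurable.aemeasurable
  have : IsProbabilityMeasure (μ.fst.map f) :=
    Measure.isProbabilityMeasure_map hf.measurable.aemeasurable
  rw [mutualInfoR, h1, h2, Measure.map_prod_map _ _ hf.measurable hh.measurable,
    klDivR_map (hf.prodMap hh) hμ, mutualInfoR]

end KLDivergence

section Translation

variable {X K : Type*} [Fintype X] [Fintype K] {w : X → ℝ}

lemma partZ_add (w : X → ℝ) (u : X → K → ℝ) (v g : K → ℝ) :
    partZ w u (g + v) = partZ (fun x => w x * Real.exp (∑ k, u x k * v k)) u g := by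
  simp only [partZ]
  refine Finset.sum_congr rfl fun x _ => ?_
  rw [cmDensity, cmDensity, mul_assoc, ← Real.exp_add]
  simp only [Pi.add_apply, mul_add, Finset.sum_add_distrib]
  ring_nf

lemma integrable_log_partZ_add (hw : ∀ x, 0 ≤ w x) (hW : 0 < ∑ x, w x) (u : X → K → ℝ)
    (v : K → ℝ) : Integrable (fun g => Real.log (partZ w u (g + v))) (stdGaussianPi K) := by
  simp_rw [partZ_add]
  obtain ⟨y, -, hy⟩ := Finset.exists_lt_of_sum_lt (s := Finset.univ)
    (f := fun _ : X => (0 : ℝ)) (g := w)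
    (by simpa using hW)
  have h := integrable_comp_partZ moderateConvex_neg_log
    (w := fun y => w y * Real.exp (∑ k, u y k * v k))
    (fun y => mul_nonneg (hw y) (Real.exp_pos _).le)
    (Finset.sum_pos' (fun y _ => mul_nonneg (hw y) (Real.exp_pos _).le)
      ⟨y, Finset.mem_univ _, mul_pos hy (Real.exp_pos _)⟩) u
  simpa using h.neg

end Translation

section GaussianChannel

lemma measurable_gaussianChannel_map {X K : Type*} [Countable X] [MeasurableSpace X]
    [MeasurableSingletonClass X] (u : X → K → ℝ) :
    Measurable fun w : X × (K → ℝ) => (w.1, w.2 + u w.1) :=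
  measurable_from_prod_countable_right fun x => by fun_prop

variable {X K : Type*} [Fintype X] [MeasurableSpace X] [Fintype K]

/-- Joint law of `(x, g + u x)` for an input `x` of law `P` and independent standard Gaussian
noise `g`. -/
def gaussianChannel (P : Measure X) (u : X → K → ℝ) : Measure (X × (K → ℝ)) :=
  (P.prod (stdGaussianPi K)).map fun w => (w.1, w.2 + u w.1)

variable [MeasurableSingletonClass X] (P : Measure X) (u : X → K → ℝ)

lemma measurable_uncurry_cmDensity :
    Measurable fun w : X × (K → ℝ) => cmDensity (u w.1) w.2 :=
  measurable_from_prod_countable_right fun x => measurable_cmDensity (u x)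

lemma gaussianChannel_eq_withDensity [SFinite P] :
    gaussianChannel P u = (P.prod (stdGaussianPi K)).withDensity
      fun w => ENNReal.ofReal (cmDensity (u w.1) w.2) := by
  ext S hS
  have hm := measurable_gaussianChannel_map u
  rw [gaussianChannel, Measure.map_apply hm hS, Measure.prod_apply (hm hS),
    withDensity_apply _ hS, ← lintegral_indicator hS,
    lintegral_prod _ ((measurable_uncurry_cmDensity u).ennreal_ofReal.indicator hS).aemeasurable]
  refine lintegral_congr fun x => ?_
  have hSx : MeasurableSet (Prod.mk x ⁻¹' S) := measurable_prodMk_left hS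
  have h1 : Prod.mk x ⁻¹' ((fun w : X × (K → ℝ) => (w.1, w.2 + u w.1)) ⁻¹' S)
      = (· + u x) ⁻¹' (Prod.mk x ⁻¹' S) := rfl
  rw [h1, ← Measure.map_apply (by fun_prop) hSx, stdGaussianPi_map_add, withDensity_apply _ hSx,
    ← lintegral_indicator hSx]
  rfl

lemma fst_gaussianChannel : (gaussianChannel P u).fst = P := by
  rw [gaussianChannel, Measure.fst, Measure.map_map measurable_fst
    (measurable_gaussianChannel_map u)]
  change (P.prod (stdGaussianPi K)).fst = P
  simp

variable [IsProbabilityMeasure P]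

instance : IsProbabilityMeasure (gaussianChannel P u) :=
  Measure.isProbabilityMeasure_map (measurable_gaussianChannel_map u).aemeasurable

lemma snd_gaussianChannel :
    (gaussianChannel P u).snd = (stdGaussianPi K).withDensity
      fun g => ENNReal.ofReal (partZ (fun x => P.real {x}) u g) := by
  ext S hS
  have hm : ∀ x, Measurable fun g => ENNReal.ofReal (cmDensity (u x) g) := fun x =>
    (measurable_cmDensity (u x)).ennreal_ofReal
  have hS' : MeasurableSet ((Set.univ : Set X) ×ˢ S) := MeasurableSet.univ.prod hS
  rw [Measure.snd_apply hS, gaussianChannel_eq_withDensity, ← Set.univ_prod,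
    withDensity_apply _ hS', withDensity_apply _ hS, ← Measure.prod_restrict,
    lintegral_prod _ (measurable_uncurry_cmDensity u).ennreal_ofReal.aemeasurable,
    Measure.restrict_univ, lintegral_fintype]
  simp_rw [partZ]
  have : ∀ g, ENNReal.ofReal (∑ x, P.real {x} * cmDensity (u x) g)
      = ∑ x, ENNReal.ofReal (cmDensity (u x) g) * P {x} := fun g => by
    rw [ENNReal.ofReal_sum_of_nonneg fun x _ => mul_nonneg measureReal_nonneg (cmDensity_pos _ _).le]
    refine Finset.sum_congr rfl fun x _ => ?_
    rw [ENNReal.ofReal_mul measureReal_nonneg, ofReal_measureReal, mul_comm]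
  simp_rw [this]
  rw [lintegral_finsetSum _ fun x _ => (hm x).mul_const _]
  exact Finset.sum_congr rfl fun x _ => (lintegral_mul_const _ (hm x)).symm

lemma prod_fst_snd_gaussianChannel :
    (gaussianChannel P u).fst.prod (gaussianChannel P u).snd
      = (P.prod (stdGaussianPi K)).withDensity
        fun w => ENNReal.ofReal (partZ (fun x => P.real {x}) u w.2) := by
  rw [fst_gaussianChannel, snd_gaussianChannel,
    prod_withDensity_right (measurable_partZ _ u).ennreal_ofReal]

lemma partZ_measureReal_pos (g : K → ℝ) : 0 < partZ (fun x => P.real {x}) u g :=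
  partZ_pos (fun _ => measureReal_nonneg) (by simp) u g

lemma gaussianChannel_absolutelyContinuous :
    gaussianChannel P u ≪ (gaussianChannel P u).fst.prod (gaussianChannel P u).snd := by
  rw [prod_fst_snd_gaussianChannel]
  have h : gaussianChannel P u ≪ P.prod (stdGaussianPi K) := by
    rw [gaussianChannel_eq_withDensity]
    exact withDensity_absolutelyContinuous _ _
  refine h.trans (withDensity_absolutelyContinuous' ?_ ?_)
  · exact ((measurable_partZ _ u).comp measurable_snd).ennreal_ofReal.aemeasurable
  · exact ae_of_all _ fun w => by simpa using partZ_measureReal_pos P u w.2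

lemma log_cmDensity_add_self (v g : K → ℝ) :
    Real.log (cmDensity v (g + v)) = ∑ k, v k * g k + (∑ k, v k ^ 2) / 2 := by
  rw [cmDensity, Real.log_exp]
  simp only [Pi.add_apply, mul_add, Finset.sum_add_distrib, pow_two]
  ring

lemma integral_sum_mul_stdGaussianPi (v : K → ℝ) :
    Integrable (fun g => ∑ k, v k * g k) (stdGaussianPi K) ∧
      ∫ g, ∑ k, v k * g k ∂(stdGaussianPi K) = 0 := by
  have hi : ∀ k, Integrable (fun g : K → ℝ => g k) (stdGaussianPi K) := fun k =>
    (ExpGrowth.coord (ι := Unit) k).integrable () (measurable_pi_apply k)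
  refine ⟨integrable_finsetSum _ fun k _ => (hi k).const_mul _, ?_⟩
  rw [integral_finsetSum _ fun k _ => (hi k).const_mul _]
  refine Finset.sum_eq_zero fun k _ => ?_
  rw [integral_const_mul]
  have : ∫ g : K → ℝ, g k ∂(stdGaussianPi K) = ∫ t, t ∂(gaussianReal 0 1) := by
    rw [← (measurePreserving_eval (fun _ : K => gaussianReal 0 1) k).map_eq,
      integral_map (measurable_pi_apply k).aemeasurable (by fun_prop)]
  rw [this]; simp

/-- Mutual information of a Gaussian channel with finitely many inputs. -/
theorem mutualInfoR_gaussianChannel :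
    mutualInfoR (gaussianChannel P u) = ∑ x, P.real {x} * ((∑ k, u x k ^ 2) / 2)
      - ∫ g, partZ (fun x => P.real {x}) u g * Real.log (partZ (fun x => P.real {x}) u g)
          ∂(stdGaussianPi K) := by
  set w : X → ℝ := fun x => P.real {x} with hw
  have hw0 : ∀ x, 0 ≤ w x := fun x => measureReal_nonneg
  have hW : 0 < ∑ x, w x := by simp [hw]
  have hac : gaussianChannel P u ≪ P.prod (stdGaussianPi K) := by
    rw [gaussianChannel_eq_withDensity]
    exact withDensity_absolutelyContinuous _ _
  have hmZ : Measurable fun y : X × (K → ℝ) => ENNReal.ofReal (partZ w u y.2) :=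
    ((measurable_partZ _ u).comp measurable_snd).ennreal_ofReal
  have hllr : llr (gaussianChannel P u)
      ((gaussianChannel P u).fst.prod (gaussianChannel P u).snd) =ᵐ[gaussianChannel P u]
      fun y => Real.log (cmDensity (u y.1) y.2) - Real.log (partZ w u y.2) := by
    rw [prod_fst_snd_gaussianChannel]
    have h1 := Measure.rnDeriv_withDensity_right (gaussianChannel P u) (P.prod (stdGaussianPi K))
      hmZ.aemeasurable (ae_of_all _ fun y => by simpa using partZ_measureReal_pos P u y.2)
      (ae_of_all _ fun y => by simp)
    have h2 := Measure.rnDeriv_withDensity (P.prod (stdGaussianPi K))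
      (measurable_uncurry_cmDensity u).ennreal_ofReal
    rw [← gaussianChannel_eq_withDensity] at h2
    filter_upwards [hac.ae_le h1, hac.ae_le h2] with y h1 h2
    have hc := cmDensity_pos (u y.1) y.2
    have hZ := partZ_pos hw0 hW u y.2
    rw [llr, h1, h2, ENNReal.toReal_mul, ENNReal.toReal_inv, ENNReal.toReal_ofReal hZ.le,
      ENNReal.toReal_ofReal hc.le, Real.log_mul (by positivity) hc.ne', Real.log_inv]
    ring
  have hmeas : Measurable fun y : X × (K → ℝ) =>
      Real.log (cmDensity (u y.1) y.2) - Real.log (partZ w u y.2) :=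
    (measurable_uncurry_cmDensity u).log.sub
      (((measurable_partZ w u).comp measurable_snd).log)
  have hint : ∀ x, Integrable (fun g => Real.log (partZ w u (g + u x))) (stdGaussianPi K) :=
    fun x => integrable_log_partZ_add hw0 hW u (u x)
  have hint' : ∀ x, Integrable (fun g => Real.log (cmDensity (u x) (g + u x))
      - Real.log (partZ w u (g + u x))) (stdGaussianPi K) := fun x => by
    simp_rw [log_cmDensity_add_self]
    exact (((integral_sum_mul_stdGaussianPi (u x)).1).add (integrable_const _)).sub (hint x)
  rw [mutualInfoR, klDivR, integral_congr_ae hllr, integral_mul_log_partZ hw0 hW u]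
  conv_lhs => rw [gaussianChannel, integral_map
    (measurable_gaussianChannel_map u).aemeasurable hmeas.aestronglyMeasurable]
  rw [integral_prod _ ?_, integral_fintype .of_finite, ← Finset.sum_sub_distrib]
  · refine Finset.sum_congr rfl fun x _ => ?_
    simp only [smul_eq_mul]
    simp_rw [log_cmDensity_add_self]
    have h1 := integral_sum_mul_stdGaussianPi (u x)
    have h2 : Integrable (fun g => ∑ k, u x k * g k + (∑ k, u x k ^ 2) / 2) (stdGaussianPi K) :=
      h1.1.add (integrable_const _)
    rw [integral_sub h2 (hint x), integral_add h1.1 (integrable_const _), h1.2, mul_sub]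
    simp [w]
  · have h1 := (hmeas.comp (measurable_gaussianChannel_map u)).aestronglyMeasurable
      (μ := P.prod (stdGaussianPi K))
    exact (integrable_prod_iff h1).2 ⟨ae_of_all _ hint', .of_finite⟩

end GaussianChannel

lemma measurableEmbedding_of_injective_of_countable {α β : Type*} [MeasurableSpace α]
    [MeasurableSpace β] [Countable α] [MeasurableSingletonClass α] [MeasurableSingletonClass β]
    {f : α → β} (hf : Function.Injective f) : MeasurableEmbedding f where
  injective := hf
  measurable := measurable_of_countable f
  measurableSet_image' s _ := ((Set.to_countable s).image f).measurableSet

section Spiked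

variable {A : Type*} [Fintype A] [MeasurableSpace A] [MeasurableSingletonClass A] {v : A → ℝ}
  {p : Measure A} [IsProbabilityMeasure p] {Δ : ℝ}

/-- Signal of the symmetric rank-one channel, in units of the noise. -/
def spike (v : A → ℝ) (Δ : ℝ) (n : ℕ) (x : Fin n → A) (q : SymIdx n) : ℝ :=
  v (x q.1.1) * v (x q.1.2) / (√n * √Δ)

/-- Product weight of a configuration. -/
def piWeight (p : Measure A) (n : ℕ) (x : Fin n → A) : ℝ := ∏ i, p.real {x i}

lemma piWeight_eq {A : Type*} [MeasurableSpace A] (p : Measure A) [IsProbabilityMeasure p] (n : ℕ)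
    (x : Fin n → A) :
    (Measure.pi fun _ : Fin n => p).real {x} = piWeight p n x := by
  rw [Measure.real, Measure.pi_singleton, ENNReal.toReal_prod]
  rfl

lemma gaussJoint_map (hΔ : 0 < Δ) (n : ℕ) :
    gaussJoint (p.map v) Δ n = (gaussianChannel (Measure.pi fun _ : Fin n => p)
      (spike v Δ n)).map (Prod.map (fun x i => v (x i)) (fun y => √Δ • y)) := by
  have hv : Measurable v := measurable_of_countable v
  have : IsProbabilityMeasure (p.map v) := Measure.isProbabilityMeasure_map hv.aemeasurable
  have h1 : (Measure.pi fun _ : Fin n => p.map v)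
      = (Measure.pi fun _ : Fin n => p).map (fun x i => v (x i)) :=
    (Measure.pi_map_pi fun _ => hv.aemeasurable).symm
  have hv' : Measurable fun (x : Fin n → A) i => v (x i) := measurable_of_countable _
  rw [gaussJoint, h1, ← Measure.map_id (μ := Measure.pi fun _ : SymIdx n => gaussianReal 0 1),
    Measure.map_prod_map _ _ hv' measurable_id, Measure.map_map (by fun_prop) (by fun_prop),
    gaussianChannel, Measure.map_map (hv'.prodMap (by fun_prop)) (measurable_gaussianChannel_map _)]
  congr 1
  ext w q
  · rfl
  · have : √Δ ≠ 0 := (Real.sqrt_pos.2 hΔ).ne'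
    simp only [Function.comp, Prod.map, spike, Pi.smul_apply, Pi.add_apply, smul_eq_mul, id]
    rw [mul_add, add_comm]
    congr 1
    by_cases hn : (√n : ℝ) = 0
    · simp [hn]
    · field_simp

theorem MI_map (hv : Function.Injective v) (hΔ : 0 < Δ) (n : ℕ) :
    MI (p.map v) Δ n = ∑ x, piWeight p n x * ((∑ q, spike v Δ n x q ^ 2) / 2)
      - ∫ g, partZ (piWeight p n) (spike v Δ n) g * Real.log (partZ (piWeight p n) (spike v Δ n) g)
          ∂(stdGaussianPi (SymIdx n)) := by
  have hv' : Function.Injective fun (x : Fin n → A) i => v (x i) := fun x y h =>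
    funext fun i => hv (congrFun h i)
  rw [MI, gaussJoint_map hΔ, mutualInfoR_map_prodMap
    (measurableEmbedding_of_injective_of_countable hv')
    (measurableEmbedding_const_smul₀ (Real.sqrt_pos.2 hΔ).ne')
    (gaussianChannel_absolutelyContinuous _ _), mutualInfoR_gaussianChannel]
  simp only [piWeight_eq]

end Spiked

lemma sum_symIdx_mul (n : ℕ) (a : Fin n → ℝ) :
    ∑ q : SymIdx n, a q.1.1 * a q.1.2 = ((∑ i, a i) ^ 2 + ∑ i, a i ^ 2) / 2 := by
  have h1 : ∑ q : SymIdx n, a q.1.1 * a q.1.2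
      = ∑ i, ∑ j, if i ≤ j then a i * a j else 0 := by
    rw [← Finset.sum_product', Finset.univ_product_univ, ← Finset.sum_filter,
      Finset.sum_subtype (p := fun q : Fin n × Fin n => q.1 ≤ q.2) _ (by simp)]
  have h2 : ∑ i, ∑ j, (if i ≤ j then a i * a j else 0)
      = ∑ i, ∑ j, if j ≤ i then a i * a j else 0 := by
    rw [Finset.sum_comm]
    simp only [mul_comm]
  have h3 : (∑ i, ∑ j, if i ≤ j then a i * a j else 0)
      + (∑ i, ∑ j, if j ≤ i then a i * a j else 0)
      = ∑ i, ∑ j, (a i * a j + if i = j then a i * a j else 0) := by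
    simp only [← Finset.sum_add_distrib]
    refine Finset.sum_congr rfl fun i _ => Finset.sum_congr rfl fun j _ => ?_
    rcases lt_trichotomy i j with h | h | h
    · simp [h.le, h.not_ge, h.ne]
    · simp [h]
    · simp [h.le, h.not_ge, h.ne']
  have h4 : ∑ i, ∑ j, (a i * a j + if i = j then a i * a j else 0)
      = (∑ i, a i) ^ 2 + ∑ i, a i ^ 2 := by
    simp only [Finset.sum_add_distrib, Finset.sum_ite_eq, Finset.mem_univ, if_true, pow_two,
      Finset.sum_mul_sum]
  linarith

lemma sum_spike_mul_spike {A : Type*} (v : A → ℝ) {Δ : ℝ} (hΔ : 0 < Δ) (n : ℕ)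
    (x y : Fin n → A) :
    ∑ q, spike v Δ n x q * spike v Δ n y q
      = ((∑ i, v (x i) * v (y i)) ^ 2 + ∑ i, (v (x i) * v (y i)) ^ 2) / (2 * n * Δ) := by
  have h : ∀ q, spike v Δ n x q * spike v Δ n y q
      = (v (x q.1.1) * v (y q.1.1)) * (v (x q.1.2) * v (y q.1.2)) * (n * Δ)⁻¹ := fun q => by
    rw [spike, spike, div_mul_div_comm, mul_mul_mul_comm (√n), Real.mul_self_sqrt n.cast_nonneg,
      Real.mul_self_sqrt hΔ.le]
    ring
  simp only [h]
  rw [← Finset.sum_mul, sum_symIdx_mul n fun i => v (x i) * v (y i), mul_assoc, mul_comm 2,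
    ← div_div, div_eq_mul_inv _ (n * Δ)]
  ring

section FiniteAlphabet

variable {A : Type*} [Fintype A] [MeasurableSpace A] [MeasurableSingletonClass A]
  (p : Measure A) [IsProbabilityMeasure p]

lemma sum_piWeight_mul (n : ℕ) (f : (Fin n → A) → ℝ) :
    ∑ x, piWeight p n x * f x = ∫ x, f x ∂(Measure.pi fun _ : Fin n => p) := by
  rw [integral_fintype .of_finite]
  simp [piWeight_eq]

lemma sum_piWeight (n : ℕ) : ∑ x, piWeight p n x = 1 := by
  simpa using sum_piWeight_mul p n 1

lemma piWeight_nonneg {A : Type*} [MeasurableSpace A] (p : Measure A) (n : ℕ) (x : Fin n → A) :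
    0 ≤ piWeight p n x :=
  Finset.prod_nonneg fun _ _ => measureReal_nonneg

lemma integral_sum_pi {Y : Type*} [MeasurableSpace Y] {μ : Measure Y} [IsProbabilityMeasure μ]
    {n : ℕ} {f : Y → ℝ} (hf : Integrable f μ) :
    Integrable (fun y : Fin n → Y => ∑ i, f (y i)) (Measure.pi fun _ => μ) ∧
    ∫ y, ∑ i, f (y i) ∂(Measure.pi fun _ : Fin n => μ) = n * ∫ y, f y ∂μ := by
  have h : ∀ i, MeasurePreserving (Function.eval i) (Measure.pi fun _ : Fin n => μ) μ :=
    measurePreserving_eval _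
  have hi : ∀ i, Integrable (fun y : Fin n → Y => f (y i)) (Measure.pi fun _ => μ) := fun i =>
    (h i).integrable_comp_of_integrable hf
  refine ⟨integrable_finsetSum _ fun i _ => hi i, ?_⟩
  rw [integral_finsetSum _ fun i _ => hi i]
  have h2 : ∀ i, ∫ y : Fin n → Y, f (y i) ∂(Measure.pi fun _ => μ) = ∫ y, f y ∂μ := fun i => by
    conv_rhs => rw [← (h i).map_eq]
    rw [integral_map (h i).measurable.aemeasurable (by rw [(h i).map_eq]; exact hf.1)]
  simp [h2]

lemma integral_sq_sum_sub_pi {Y : Type*} [MeasurableSpace Y] {μ : Measure Y}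
    [IsProbabilityMeasure μ] {n : ℕ} {f : Y → ℝ} (hf : MemLp f 2 μ) :
    Integrable (fun y : Fin n → Y => (∑ i, f (y i) - n * ∫ y, f y ∂μ) ^ 2)
      (Measure.pi fun _ => μ) ∧
    ∫ y, (∑ i, f (y i) - n * ∫ y, f y ∂μ) ^ 2 ∂(Measure.pi fun _ : Fin n => μ)
      = n * Var[f; μ] := by
  have h := variance_sum_pi (ι := Fin n) (μ := fun _ => μ) (X := fun _ => f) fun _ => hf
  have e : (∑ i, fun y : Fin n → Y => f (y i)) = fun y => ∑ i, f (y i) := by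
    ext; simp
  have hm : MemLp (fun y : Fin n → Y => ∑ i, f (y i)) 2 (Measure.pi fun _ => μ) :=
    memLp_finsetSum _ fun i _ => hf.comp_measurePreserving (measurePreserving_eval _ i)
  have h2 := (integral_sum_pi (n := n) (hf.integrable one_le_two)).2
  refine ⟨(hm.sub (memLp_const _)).integrable_sq, ?_⟩
  rw [e, variance_eq_integral hm.aemeasurable, h2] at h
  simpa using h

lemma integral_abs_sum_sub_pi_le {Y : Type*} [MeasurableSpace Y] {μ : Measure Y}
    [IsProbabilityMeasure μ] {n : ℕ} (hn : 0 < n) {f : Y → ℝ} (hf : MemLp f 2 μ) :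
    Integrable (fun y : Fin n → Y => |∑ i, f (y i) - n * ∫ y, f y ∂μ|) (Measure.pi fun _ => μ) ∧
    ∫ y, |∑ i, f (y i) - n * ∫ y, f y ∂μ| ∂(Measure.pi fun _ : Fin n => μ)
      ≤ √n / 2 * (Var[f; μ] + 1) := by
  obtain ⟨h1, h2⟩ := integral_sq_sum_sub_pi (n := n) hf
  have hi : Integrable (fun y : Fin n → Y => |∑ i, f (y i) - n * ∫ y, f y ∂μ|)
      (Measure.pi fun _ => μ) :=
    ((integral_sum_pi (hf.integrable one_le_two)).1.sub (integrable_const _)).abs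
  refine ⟨hi, ?_⟩
  have hs : (0 : ℝ) < √n := Real.sqrt_pos.2 (by exact_mod_cast hn)
  have hs2 : √(n : ℝ) ^ 2 = n := Real.sq_sqrt n.cast_nonneg
  calc _ ≤ ∫ y : Fin n → Y, ((2 * √n)⁻¹ * (∑ i, f (y i) - n * ∫ y, f y ∂μ) ^ 2 + √n / 2)
        ∂(Measure.pi fun _ => μ) := by
        refine integral_mono hi ((h1.const_mul _).add (integrable_const _)) fun y => ?_
        simp only
        set S := ∑ i, f (y i) - n * ∫ y, f y ∂μ
        have : (2 * √n)⁻¹ * S ^ 2 + √n / 2 - |S| = (2 * √n)⁻¹ * (|S| - √n) ^ 2 := by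
          rw [← sq_abs S]; field_simp; ring
        nlinarith [mul_nonneg (inv_nonneg.2 (by positivity : 0 ≤ 2 * √(n : ℝ))) (sq_nonneg (|S| - √n))]
    _ = _ := by
        rw [integral_add (h1.const_mul _) (integrable_const _), integral_const_mul, h2]
        simp
        field_simp
        rw [hs2]; ring

/-- Averaging over a planted configuration and independent Gaussian noise is averaging over
i.i.d. pairs. -/
lemma sum_piWeight_mul_integral {n : ℕ} {F : (Fin n → A) → (Fin n → ℝ) → ℝ}
    (hF : ∀ x, Measurable (F x)) (hi : ∀ x, Integrable (F x) (stdGaussianPi (Fin n))) :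
    Integrable (fun y : Fin n → A × ℝ => F (fun i => (y i).1) fun i => (y i).2)
      (Measure.pi fun _ => p.prod (gaussianReal 0 1)) ∧
    ∑ x, piWeight p n x * ∫ g, F x g ∂(stdGaussianPi (Fin n)) =
      ∫ y, F (fun i => (y i).1) (fun i => (y i).2)
        ∂(Measure.pi fun _ : Fin n => p.prod (gaussianReal 0 1)) := by
  have hm : Measurable (Function.uncurry F) := measurable_from_prod_countable_right hF
  have hI : Integrable (Function.uncurry F)
      ((Measure.pi fun _ : Fin n => p).prod (stdGaussianPi (Fin n))) :=
    (integrable_prod_iff hm.aestronglyMeasurable).2 ⟨ae_of_all _ hi, .of_finite⟩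
  have hmp := measurePreserving_arrowProdEquivProdArrow A ℝ (Fin n) (fun _ => p)
    fun _ => gaussianReal 0 1
  refine ⟨hmp.integrable_comp_of_integrable hI, ?_⟩
  rw [sum_piWeight_mul p n fun x => ∫ g, F x g ∂(stdGaussianPi (Fin n))]
  exact (integral_prod _ hI).symm.trans (hmp.integral_comp' (Function.uncurry F)).symm

end FiniteAlphabet

section SiteFreeEnergy

variable {A : Type*} [Fintype A] [MeasurableSpace A] [MeasurableSingletonClass A] {v : A → ℝ}
  {p : Measure A} [IsProbabilityMeasure p] {Δ q : ℝ}

lemma Jf_map (a b : ℝ) :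
    Jf (p.map v) a b = Real.log (∑ x, p.real {x} * Real.exp (b * v x - a * v x ^ 2 / 2)) := by
  rw [Jf, integral_map (measurable_of_countable v).aemeasurable (by fun_prop),
    integral_fintype .of_finite]
  simp

lemma sum_mul_exp_pos (f : A → ℝ) : 0 < ∑ x, p.real {x} * Real.exp (f x) := by
  have h := integral_exp_pos (μ := p) (f := f) .of_finite
  rwa [integral_fintype .of_finite] at h

lemma exp_Jf_map (a b : ℝ) :
    Real.exp (Jf (p.map v) a b) = ∑ x, p.real {x} * Real.exp (b * v x - a * v x ^ 2 / 2) := by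
  rw [Jf_map, Real.exp_log (sum_mul_exp_pos _)]

lemma abs_Jf_map_le {B : ℝ} (hB : ∀ x, |v x| ≤ B) {a : ℝ} (ha : 0 ≤ a) (b : ℝ) :
    |Jf (p.map v) a b| ≤ |b| * B + a * B ^ 2 / 2 := by
  have hsum : ∑ x, p.real {x} = 1 := by simp
  have h : ∀ x, |b * v x - a * v x ^ 2 / 2| ≤ |b| * B + a * B ^ 2 / 2 := fun x => by
    refine (abs_sub _ _).trans (add_le_add ?_ ?_)
    · rw [abs_mul]; exact mul_le_mul_of_nonneg_left (hB x) (abs_nonneg b)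
    · rw [abs_of_nonneg (by positivity)]
      have := sq_le_sq' (abs_le.1 (hB x)).1 (abs_le.1 (hB x)).2
      gcongr
  set c := |b| * B + a * B ^ 2 / 2
  rw [abs_le]
  constructor
  · rw [← Real.exp_le_exp, exp_Jf_map, ← one_mul (Real.exp (-c)), ← hsum, Finset.sum_mul]
    exact Finset.sum_le_sum fun x _ => mul_le_mul_of_nonneg_left
      (Real.exp_le_exp.2 (abs_le.1 (h x)).1) measureReal_nonneg
  · rw [← Real.exp_le_exp, exp_Jf_map, ← one_mul (Real.exp c), ← hsum, Finset.sum_mul]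
    exact Finset.sum_le_sum fun x _ => mul_le_mul_of_nonneg_left
      (Real.exp_le_exp.2 (abs_le.1 (h x)).2) measureReal_nonneg

/-- Free energy of a single site with planted value `y.1` and noise `y.2`. -/
def siteLog (p : Measure A) (v : A → ℝ) (Δ q m : ℝ) (y : A × ℝ) : ℝ :=
  Jf (p.map v) (q / Δ) (m * v y.1 / Δ + √(q / Δ) * y.2)

lemma measurable_siteLog (m : ℝ) : Measurable (siteLog p v Δ q m) := by
  refine measurable_from_prod_countable_right fun x => ?_
  simp only [siteLog, Jf_map]
  fun_prop

lemma memLp_siteLog (hΔ : 0 < Δ) (hq : 0 ≤ q) (m : ℝ) :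
    MemLp (siteLog p v Δ q m) 2 (p.prod (gaussianReal 0 1)) := by
  set B := ∑ x, |v x|
  have hB : ∀ x, |v x| ≤ B := fun x =>
    Finset.single_le_sum (f := fun x => |v x|) (fun _ _ => abs_nonneg _) (Finset.mem_univ x)
  have hB0 : 0 ≤ B := Finset.sum_nonneg fun _ _ => abs_nonneg _
  have hz : MemLp (fun y : A × ℝ => |y.2|) 2 (p.prod (gaussianReal 0 1)) :=
    ((memLp_id_gaussianReal 2).comp_measurePreserving measurePreserving_snd).abs
  refine ((hz.const_mul (√(q / Δ) * B)).add
    (memLp_const (|m| * B / Δ * B + q / Δ * B ^ 2 / 2))).mono'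
    (measurable_siteLog m).aestronglyMeasurable (ae_of_all _ fun y => ?_)
  rw [Real.norm_eq_abs, siteLog]
  refine (abs_Jf_map_le hB (by positivity) _).trans ?_
  have h : |m * v y.1 / Δ + √(q / Δ) * y.2| ≤ |m| * B / Δ + √(q / Δ) * |y.2| := by
    refine (abs_add_le _ _).trans (add_le_add ?_ ?_)
    · rw [abs_div, abs_mul, abs_of_pos hΔ]
      have := hB y.1
      gcongr
    · rw [abs_mul, abs_of_nonneg (Real.sqrt_nonneg _)]
  have := mul_le_mul_of_nonneg_right h hB0
  simp only [Pi.add_apply]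
  linarith

lemma integral_siteLog {A : Type*} [MeasurableSpace A] {v : A → ℝ} {p : Measure A}
    [IsProbabilityMeasure p] (hv : MeasurableEmbedding v) (m : ℝ) :
    ∫ w : ℝ × ℝ, Jf (p.map v) (q / Δ) (m * w.1 / Δ + √(q / Δ) * w.2)
      ∂((p.map v).prod (gaussianReal 0 1))
      = ∫ y, siteLog p v Δ q m y ∂(p.prod (gaussianReal 0 1)) := by
  have : IsProbabilityMeasure (p.map v) :=
    Measure.isProbabilityMeasure_map hv.measurable.aemeasurable
  have h := Measure.map_prod_map p (gaussianReal 0 1) hv.measurable measurable_id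
  rw [Measure.map_id] at h
  rw [h, (hv.prodMap MeasurableEmbedding.id).integral_map]
  rfl

/-- A linear Gaussian field on a product measure has a product partition function. -/
lemma sum_piWeight_mul_exp_mul_cmDensity (hΔ : 0 < Δ) (hq : 0 ≤ q) (n : ℕ) (m : ℝ)
    (x : Fin n → A) (g : Fin n → ℝ) :
    ∑ y, piWeight p n y * Real.exp (m / Δ * ∑ i, v (x i) * v (y i))
        * cmDensity (fun i => √(q / Δ) * v (y i)) g
      = Real.exp (∑ i, siteLog p v Δ q m (x i, g i)) := by
  rw [Real.exp_sum]
  simp only [siteLog, exp_Jf_map]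
  rw [Finset.prod_univ_sum, Fintype.piFinset_univ]
  refine Finset.sum_congr rfl fun y _ => ?_
  rw [Finset.prod_mul_distrib, ← Real.exp_sum, piWeight, mul_assoc, cmDensity, ← Real.exp_add]
  congr 2
  rw [Finset.mul_sum, Finset.sum_div, ← Finset.sum_sub_distrib, ← Finset.sum_add_distrib]
  refine Finset.sum_congr rfl fun i _ => ?_
  rw [mul_pow, Real.sq_sqrt (by positivity)]
  ring

end SiteFreeEnergy

section FreeEnergyBounds

variable {A : Type*} [Fintype A] [MeasurableSpace A] [MeasurableSingletonClass A] {v : A → ℝ}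
  {p : Measure A} [IsProbabilityMeasure p] {Δ q : ℝ} {n : ℕ}

lemma sum_sqrt_mul_sqrt {A : Type*} (v : A → ℝ) (hΔ : 0 < Δ) (hq : 0 ≤ q) (x y : Fin n → A) :
    ∑ i, √(q / Δ) * v (x i) * (√(q / Δ) * v (y i)) = q / Δ * ∑ i, v (y i) * v (x i) := by
  rw [Finset.mul_sum]
  refine Finset.sum_congr rfl fun i _ => ?_
  have := Real.mul_self_sqrt (by positivity : 0 ≤ q / Δ)
  linear_combination v (x i) * v (y i) * this

lemma sum_sqrt_mul_sqrt_le {A : Type*} (v : A → ℝ) (hΔ : 0 < Δ) (hq : 0 ≤ q) (hn : 0 < n)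
    (x y : Fin n → A) :
    ∑ i, √(q / Δ) * v (x i) * (√(q / Δ) * v (y i))
      ≤ ∑ k, spike v Δ n x k * spike v Δ n y k + n * q ^ 2 / (2 * Δ) := by
  have hn' : (0 : ℝ) < n := by exact_mod_cast hn
  rw [sum_sqrt_mul_sqrt v hΔ hq, sum_spike_mul_spike v hΔ]
  simp only [mul_comm (v (y _))]
  set S := ∑ i, v (x i) * v (y i)
  have h0 : 0 ≤ ∑ i, (v (x i) * v (y i)) ^ 2 := Finset.sum_nonneg fun _ _ => sq_nonneg _
  have : (S ^ 2 + ∑ i, (v (x i) * v (y i)) ^ 2) / (2 * n * Δ) + n * q ^ 2 / (2 * Δ) - q / Δ * S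
      = ((S - n * q) ^ 2 + ∑ i, (v (x i) * v (y i)) ^ 2) / (2 * n * Δ) := by
    field_simp; ring
  have h2 : 0 ≤ ((S - n * q) ^ 2 + ∑ i, (v (x i) * v (y i)) ^ 2) / (2 * n * Δ) := by positivity
  linarith

/-- Replica-symmetric lower bound on the planted free energy. -/
theorem le_integral_mul_log_partZ_spike (hΔ : 0 < Δ) (hq : 0 ≤ q) (hn : 0 < n) :
    n * ∫ y, siteLog p v Δ q q y ∂(p.prod (gaussianReal 0 1)) - n * q ^ 2 / (4 * Δ)
      ≤ ∫ g, partZ (piWeight p n) (spike v Δ n) g * Real.log (partZ (piWeight p n) (spike v Δ n) g)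
          ∂(stdGaussianPi (SymIdx n)) := by
  set b : (Fin n → A) → Fin n → ℝ := fun x i => √(q / Δ) * v (x i)
  have hbb : ∀ x y, ∑ i, b x i * b y i = q / Δ * ∑ i, v (y i) * v (x i) := fun x y =>
    sum_sqrt_mul_sqrt v hΔ hq x y
  have hw := piWeight_nonneg p n
  have hW := sum_piWeight p n
  have hsite : ∀ x g, Real.log (partZ (piWeight p n) b (g + b x))
      = ∑ i, siteLog p v Δ q q (x i, g i) := fun x g => by
    rw [partZ_add, partZ]
    simp only [hbb]
    rw [sum_piWeight_mul_exp_mul_cmDensity hΔ hq, Real.log_exp]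
  have h1 := integral_mul_log_partZ_le hw hW (spike v Δ n) b
    (sum_sqrt_mul_sqrt_le v hΔ hq hn)
  rw [integral_mul_log_partZ hw (hW ▸ one_pos) b,
    (sum_piWeight_mul_integral p (F := fun x g => Real.log (partZ (piWeight p n) b (g + b x)))
      (fun x => by fun_prop) fun x => integrable_log_partZ_add hw (hW ▸ one_pos) b (b x)).2] at h1
  simp only [hsite, Prod.mk.eta] at h1
  rw [(integral_sum_pi ((memLp_siteLog hΔ hq q).integrable one_le_two)).2] at h1
  have : n * q ^ 2 / (2 * Δ) / 2 = n * q ^ 2 / (4 * Δ) := by ring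
  linarith

lemma log_sum_exp_le {ι : Type*} {s : Finset ι} (hs : s.Nonempty) {f : ι → ℝ} {c : ℝ}
    (h : ∀ i ∈ s, f i ≤ c) : Real.log (∑ i ∈ s, Real.exp (f i)) ≤ Real.log s.card + c := by
  have h1 : ∑ i ∈ s, Real.exp (f i) ≤ s.card * Real.exp c := by
    rw [← nsmul_eq_mul]
    exact Finset.sum_le_card_nsmul _ _ _ fun i hi => Real.exp_le_exp.2 (h i hi)
  have h2 : (0 : ℝ) < s.card := by exact_mod_cast hs.card_pos
  calc _ ≤ Real.log (s.card * Real.exp c) :=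
        Real.log_le_log (Finset.sum_pos (fun _ _ => Real.exp_pos _) hs) h1
    _ = _ := by rw [Real.log_mul h2.ne' (Real.exp_pos _).ne', Real.log_exp]

/-- The planted coupling is dominated by a finite family of linear couplings. -/
lemma exp_sum_spike_mul_spike_le {A : Type*} {v : A → ℝ} (hΔ : 0 < Δ) (hn : 0 < n) {B ε : ℝ}
    (hB : ∀ a, |v a| ≤ B)
    {M : Finset ℝ} (hM : ∀ R, |R| ≤ B ^ 2 → ∃ m ∈ M, (R - m) ^ 2 ≤ ε) (x y : Fin n → A) :
    Real.exp (∑ k, spike v Δ n y k * spike v Δ n x k)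
      ≤ Real.exp (n * ε / (2 * Δ) + B ^ 4 / (2 * Δ))
        * ∑ m ∈ M, Real.exp (m / Δ * ∑ i, v (x i) * v (y i) - n * m ^ 2 / (2 * Δ)) := by
  have hn' : (0 : ℝ) < n := by exact_mod_cast hn
  have hxy : ∀ i, |v (x i) * v (y i)| ≤ B ^ 2 := fun i => by
    rw [abs_mul, pow_two]
    exact mul_le_mul (hB _) (hB _) (abs_nonneg _) ((abs_nonneg _).trans (hB (x i)))
  rw [sum_spike_mul_spike v hΔ]
  simp only [mul_comm (v (y _))]
  set S := ∑ i, v (x i) * v (y i) with hS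
  have hS1 : |S| ≤ n * B ^ 2 := by
    refine (Finset.abs_sum_le_sum_abs _ _).trans ?_
    simpa using Finset.sum_le_sum fun i (_ : i ∈ Finset.univ) => hxy i
  have hS2 : ∑ i, (v (x i) * v (y i)) ^ 2 ≤ n * B ^ 4 := by
    have : ∀ i, (v (x i) * v (y i)) ^ 2 ≤ B ^ 4 := fun i => by
      have := pow_le_pow_left₀ (abs_nonneg _) (hxy i) 2
      rw [sq_abs] at this
      linarith [this, (by ring : (B ^ 2) ^ 2 = B ^ 4)]
    simpa using Finset.sum_le_sum fun i (_ : i ∈ Finset.univ) => this i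
  obtain ⟨m, hm, hR⟩ := hM (S / n) (by
    rw [abs_div, abs_of_pos hn', div_le_iff₀ hn']; linarith)
  rw [Finset.mul_sum]
  refine le_trans ?_ (Finset.single_le_sum (fun m _ => by positivity) hm)
  rw [← Real.exp_add, Real.exp_le_exp]
  have h1 : n * ε / (2 * Δ) + B ^ 4 / (2 * Δ) + (m / Δ * S - n * m ^ 2 / (2 * Δ))
      - (S ^ 2 + ∑ i, (v (x i) * v (y i)) ^ 2) / (2 * n * Δ)
      = (n ^ 2 * (ε - (S / n - m) ^ 2) + (n * B ^ 4 - ∑ i, (v (x i) * v (y i)) ^ 2))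
        / (2 * n * Δ) := by
    field_simp; ring
  have h2 : 0 ≤ (n ^ 2 * (ε - (S / n - m) ^ 2) + (n * B ^ 4 - ∑ i, (v (x i) * v (y i)) ^ 2))
        / (2 * n * Δ) := by
    have := mul_nonneg (sq_nonneg (n : ℝ)) (sub_nonneg.2 hR)
    exact div_nonneg (by linarith) (by positivity)
  linarith

/-- Upper bound on the planted free energy, uniform over a finite net `M` of overlaps. -/
theorem integral_mul_log_partZ_spike_le (hΔ : 0 < Δ) (hq : 0 ≤ q) (hn : 0 < n) {B ε l : ℝ}
    (hB : ∀ a, |v a| ≤ B) {M : Finset ℝ} (hM : ∀ R, |R| ≤ B ^ 2 → ∃ m ∈ M, (R - m) ^ 2 ≤ ε)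
    (hl : ∀ m ∈ M, ∫ y, siteLog p v Δ q m y ∂(p.prod (gaussianReal 0 1)) - m ^ 2 / (2 * Δ) ≤ l) :
    ∫ g, partZ (piWeight p n) (spike v Δ n) g * Real.log (partZ (piWeight p n) (spike v Δ n) g)
        ∂(stdGaussianPi (SymIdx n))
      ≤ n * (l + q ^ 2 / (4 * Δ) + ε / (2 * Δ)) + (B ^ 4 / (2 * Δ) + Real.log M.card)
        + √n / 2 * ∑ m ∈ M, (Var[siteLog p v Δ q m; p.prod (gaussianReal 0 1)] + 1) := by
  have hn' : (0 : ℝ) < n := by exact_mod_cast hn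
  have hMne : M.Nonempty := by
    obtain ⟨m, hm, -⟩ := hM 0 (by simpa using sq_nonneg B)
    exact ⟨m, hm⟩
  have hw := piWeight_nonneg p n
  have hW : 0 < ∑ x, piWeight p n x := by rw [sum_piWeight]; exact one_pos
  set W : (Fin n → A) → ↥M × (Fin n → A) → ℝ := fun x σ => piWeight p n σ.2
    * Real.exp (σ.1 / Δ * ∑ i, v (x i) * v (σ.2 i) - n * (σ.1 : ℝ) ^ 2 / (2 * Δ)) with hWdef
  have hW0 : ∀ x σ, 0 ≤ W x σ := fun x σ => mul_nonneg (hw _) (Real.exp_pos _).le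
  have hWpos : ∀ x, 0 < ∑ σ, W x σ := fun x => by
    obtain ⟨y, -, hy⟩ := Finset.exists_lt_of_sum_lt (s := Finset.univ)
      (f := fun _ : Fin n → A => (0 : ℝ)) (g := piWeight p n) (by simpa using hW)
    obtain ⟨m, hm⟩ := hMne
    exact Finset.sum_pos' (fun σ _ => hW0 x σ)
      ⟨(⟨m, hm⟩, y), Finset.mem_univ _, mul_pos hy (Real.exp_pos _)⟩
  set a : ↥M × (Fin n → A) → SymIdx n → ℝ := fun σ => spike v Δ n σ.2
  set b : ↥M × (Fin n → A) → Fin n → ℝ := fun σ i => √(q / Δ) * v (σ.2 i) with hb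
  set κ := n * ε / (2 * Δ) + B ^ 4 / (2 * Δ) with hκ
  have hnet : ∀ x g, Real.log (partZ (piWeight p n) (spike v Δ n) (g + spike v Δ n x))
      ≤ κ + Real.log (partZ (W x) a g) := fun x g => by
    have h1 : partZ (piWeight p n) (spike v Δ n) (g + spike v Δ n x)
        ≤ Real.exp κ * partZ (W x) a g := by
      rw [partZ_add, partZ, partZ, Fintype.sum_prod_type_right, Finset.mul_sum]
      refine Finset.sum_le_sum fun y _ => ?_
      simp only [hWdef, a, ← Finset.sum_mul, ← Finset.mul_sum]
      have h := exp_sum_spike_mul_spike_le hΔ hn hB hM x y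
      rw [← Finset.sum_coe_sort M, ← hκ] at h
      have := mul_le_mul_of_nonneg_left h
        (mul_nonneg (hw y) (cmDensity_pos (spike v Δ n y) g).le)
      linarith
    calc _ ≤ _ := Real.log_le_log (partZ_pos hw hW _ _) h1
      _ = _ := by
        rw [Real.log_mul (Real.exp_pos _).ne' (partZ_pos (hW0 x) (hWpos x) _ _).ne', Real.log_exp]
  have hlin : ∀ x g, partZ (W x) b g
      = ∑ m ∈ M, Real.exp (∑ i, siteLog p v Δ q m (x i, g i) - n * m ^ 2 / (2 * Δ)) := fun x g => by
    rw [← Finset.sum_coe_sort M, partZ, Fintype.sum_prod_type]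
    refine Finset.sum_congr rfl fun m _ => ?_
    rw [sub_eq_add_neg, Real.exp_add, ← sum_piWeight_mul_exp_mul_cmDensity hΔ hq, Finset.sum_mul]
    refine Finset.sum_congr rfl fun y _ => ?_
    simp only [hWdef, hb, sub_eq_add_neg, Real.exp_add]
    ring
  have hcov : ∀ σ τ, ∑ i, b σ i * b τ i ≤ ∑ k, a σ k * a τ k + n * q ^ 2 / (2 * Δ) :=
    fun σ τ => sum_sqrt_mul_sqrt_le v hΔ hq hn σ.2 τ.2
  have hint : ∀ {L : Type} [Fintype L] (x) (u : ↥M × (Fin n → A) → L → ℝ),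
      Integrable (fun g => Real.log (partZ (W x) u g)) (stdGaussianPi L) := fun x u => by
    simpa using integrable_log_partZ_add (hW0 x) (hWpos x) u 0
  have hx : ∀ x, ∫ g, Real.log (partZ (piWeight p n) (spike v Δ n) (g + spike v Δ n x))
        ∂(stdGaussianPi (SymIdx n))
      ≤ κ + n * q ^ 2 / (4 * Δ) + ∫ g, Real.log (partZ (W x) b g) ∂(stdGaussianPi (Fin n)) :=
    fun x => by
      have h1 := integral_mono (integrable_log_partZ_add hw hW (spike v Δ n) (spike v Δ n x))
        ((integrable_const κ).add (hint x a)) (hnet x)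
      have h2 := integral_log_partZ_le (hW0 x) (hWpos x) a b hcov
      rw [integral_add' (integrable_const κ) (hint x a)] at h1
      simp only [integral_const, probReal_univ, one_smul] at h1
      have : n * q ^ 2 / (2 * Δ) / 2 = n * q ^ 2 / (4 * Δ) := by ring
      linarith
  have hsum := sum_piWeight_mul_integral p (F := fun x g => Real.log (partZ (W x) b g))
      (fun x => by fun_prop) fun x => hint x b
  set E : ℝ → ℝ := fun m => ∫ y, siteLog p v Δ q m y ∂(p.prod (gaussianReal 0 1))
  have hdev : ∀ y : Fin n → A × ℝ, Real.log (partZ (W fun i => (y i).1) b fun i => (y i).2)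
      ≤ Real.log M.card + n * l + ∑ m ∈ M, |∑ i, siteLog p v Δ q m (y i) - n * E m| := fun y => by
    rw [hlin, add_assoc]
    refine log_sum_exp_le hMne fun m hm => ?_
    have h1 := le_abs_self (∑ i, siteLog p v Δ q m (y i) - n * E m)
    have h2 := Finset.single_le_sum (f := fun m => |∑ i, siteLog p v Δ q m (y i) - n * E m|)
      (fun _ _ => abs_nonneg _) hm
    have h3 := mul_le_mul_of_nonneg_left (hl m hm) hn'.le
    simp only [Prod.mk.eta] at h2 ⊢
    have h4 : n * (E m - m ^ 2 / (2 * Δ)) = n * E m - n * m ^ 2 / (2 * Δ) := by ring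
    linarith
  have hdevi := fun m => integral_abs_sum_sub_pi_le hn (memLp_siteLog (v := v) (p := p) hΔ hq m)
  have hfin := integral_mono hsum.1 ((integrable_const (Real.log M.card + n * l)).add
    (integrable_finsetSum M fun m _ => (hdevi m).1)) hdev
  rw [integral_add' (integrable_const _) (integrable_finsetSum M fun m _ => (hdevi m).1),
    integral_finsetSum M fun m _ => (hdevi m).1] at hfin
  simp only [integral_const, probReal_univ, one_smul] at hfin
  have hvar := Finset.sum_le_sum fun m (_ : m ∈ M) => (hdevi m).2
  rw [integral_mul_log_partZ hw hW]
  calc _ ≤ ∑ x, piWeight p n x * (κ + n * q ^ 2 / (4 * Δ)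
        + ∫ g, Real.log (partZ (W x) b g) ∂(stdGaussianPi (Fin n))) :=
        Finset.sum_le_sum fun x _ => mul_le_mul_of_nonneg_left (hx x) (hw x)
    _ = κ + n * q ^ 2 / (4 * Δ) + ∑ x, piWeight p n x
        * ∫ g, Real.log (partZ (W x) b g) ∂(stdGaussianPi (Fin n)) := by
        simp only [mul_add, Finset.sum_add_distrib, ← Finset.sum_mul, sum_piWeight, one_mul]
    _ ≤ _ := by
        rw [hsum.2, Finset.mul_sum]
        have : n * (l + q ^ 2 / (4 * Δ) + ε / (2 * Δ))
          = n * l + n * q ^ 2 / (4 * Δ) + n * ε / (2 * Δ) := by ring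
        linarith

end FreeEnergyBounds

lemma exists_finset_sq_sub_le (r : ℝ) {ε : ℝ} (hε : 0 < ε) :
    ∃ M : Finset ℝ, ∀ R, |R| ≤ r → ∃ m ∈ M, (R - m) ^ 2 ≤ ε := by
  obtain ⟨t, -, ht, hcov⟩ := (isCompact_Icc (a := -r) (b := r)).finite_cover_balls
    (Real.sqrt_pos.2 hε)
  refine ⟨ht.toFinset, fun R hR => ?_⟩
  obtain ⟨m, hm, hRm⟩ := Set.mem_iUnion₂.1 (hcov (Set.mem_Icc.2 (abs_le.1 hR)))
  refine ⟨m, ht.mem_toFinset.2 hm, ?_⟩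
  rw [Metric.mem_ball, Real.dist_eq] at hRm
  rw [← sq_abs]
  exact (pow_le_pow_left₀ (abs_nonneg _) hRm.le 2).trans (Real.sq_sqrt hε.le).le

section MutualInformationLimit

variable {A : Type*} [Fintype A] [MeasurableSpace A] [MeasurableSingletonClass A] {v : A → ℝ}
  {p : Measure A} [IsProbabilityMeasure p] {Δ q : ℝ} {n : ℕ}

lemma sum_piWeight_mul_spike_sq (hΔ : 0 < Δ) (hn : 0 < n) :
    ∑ x, piWeight p n x * ((∑ k, spike v Δ n x k ^ 2) / 2)
      = n * ((∫ a, v a ^ 2 ∂p) ^ 2 / (4 * Δ))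
        + (Var[fun a => v a ^ 2; p] + ∫ a, v a ^ 4 ∂p) / (4 * Δ) := by
  have hn' : (0 : ℝ) < n := by exact_mod_cast hn
  have hL : MemLp (fun a => v a ^ 2) 2 p :=
    memLp_two_iff_integrable_sq (measurable_of_countable _).aestronglyMeasurable |>.2 .of_finite
  obtain ⟨i1, h1⟩ := integral_sq_sum_sub_pi (n := n) hL
  obtain ⟨i2, h2⟩ := integral_sum_pi (n := n) (hL.integrable one_le_two)
  obtain ⟨i4, h4⟩ := integral_sum_pi (n := n) (μ := p) (f := fun a => v a ^ 4) .of_finite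
  set V := ∫ a, v a ^ 2 ∂p
  have e : ∀ x : Fin n → A, (∑ k, spike v Δ n x k ^ 2) / 2
      = (4 * n * Δ)⁻¹ * ((∑ i, v (x i) ^ 2 - n * V) ^ 2 + 2 * n * V * ∑ i, v (x i) ^ 2
        - n ^ 2 * V ^ 2 + ∑ i, v (x i) ^ 4) := fun x => by
    have h := sum_spike_mul_spike v hΔ n x x
    simp only [← pow_two, ← pow_mul] at h
    rw [h]
    field_simp
    ring_nf
  simp only [e]
  rw [sum_piWeight_mul p n fun x => _, integral_const_mul, integral_add (by fun_prop) i4,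
    integral_sub (by fun_prop) (by fun_prop), integral_add i1 (by fun_prop), integral_const_mul,
    h1, h2, h4]
  simp
  field_simp
  ring

theorem tendsto_MI_map (hv : MeasurableEmbedding v) (hΔ : 0 < Δ) (hq : 0 ≤ q)
    (hL : ∀ m : ℝ, iL (p.map v) Δ q q ≤ iL (p.map v) Δ q m) :
    Tendsto (fun n : ℕ => MI (p.map v) Δ n / n) atTop (nhds (iB (p.map v) Δ q)) := by
  have hV : ∫ x, x ^ 2 ∂(p.map v) = ∫ a, v a ^ 2 ∂p := hv.integral_map _
  simp only [iL, iB, hV, integral_siteLog hv] at hL ⊢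
  set V := ∫ a, v a ^ 2 ∂p with hVdef
  set E : ℝ → ℝ := fun m => ∫ y, siteLog p v Δ q m y ∂(p.prod (gaussianReal 0 1)) with hE
  set C := (Var[fun a => v a ^ 2; p] + ∫ a, v a ^ 4 ∂p) / (4 * Δ) with hC
  set B := ∑ a, |v a|
  have hB : ∀ a, |v a| ≤ B := fun a =>
    Finset.single_le_sum (f := fun a => |v a|) (fun _ _ => abs_nonneg _) (Finset.mem_univ a)
  have hl : ∀ m, E m - m ^ 2 / (2 * Δ) ≤ E q - q ^ 2 / (2 * Δ) := fun m => by
    have h := hL m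
    have e1 : (2 * m ^ 2 - q ^ 2 + V ^ 2) / (4 * Δ)
      = m ^ 2 / (2 * Δ) + (V ^ 2 - q ^ 2) / (4 * Δ) := by field_simp; ring
    have e2 : (2 * q ^ 2 - q ^ 2 + V ^ 2) / (4 * Δ)
      = q ^ 2 / (2 * Δ) + (V ^ 2 - q ^ 2) / (4 * Δ) := by field_simp; ring
    simp only [e1, e2] at h
    linarith
  have hMI : ∀ n : ℕ, 0 < n → MI (p.map v) Δ n = n * (V ^ 2 / (4 * Δ)) + C
      - ∫ g, partZ (piWeight p n) (spike v Δ n) g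
          * Real.log (partZ (piWeight p n) (spike v Δ n) g) ∂(stdGaussianPi (SymIdx n)) :=
    fun n hn => by rw [MI_map hv.injective hΔ, sum_piWeight_mul_spike_sq hΔ hn]
  have hlim : ∀ a : ℝ, Tendsto (fun n : ℕ => a / n) atTop (nhds 0) :=
    tendsto_const_div_atTop_nhds_zero_nat
  have hlim' : ∀ a : ℝ, Tendsto (fun n : ℕ => a / √n) atTop (nhds 0) := fun a =>
    (tendsto_const_nhds (x := a)).div_atTop
      (Real.tendsto_sqrt_atTop.comp tendsto_natCast_atTop_atTop)
  have eq0 : (q ^ 2 + V ^ 2) / (4 * Δ) = q ^ 2 / (4 * Δ) + V ^ 2 / (4 * Δ) := add_div _ _ _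
  set L := (q ^ 2 + V ^ 2) / (4 * Δ) - E q with hLdef
  refine tendsto_order.2 ⟨fun a ha => ?_, fun a ha => ?_⟩
  · set ε := Δ * (L - a) with hε
    have hε0 : 0 < ε := mul_pos hΔ (sub_pos.2 ha)
    obtain ⟨M, hM⟩ := exists_finset_sq_sub_le (B ^ 2) hε0
    set c := B ^ 4 / (2 * Δ) + Real.log M.card
    set D := (∑ m ∈ M, (Var[siteLog p v Δ q m; p.prod (gaussianReal 0 1)] + 1)) / 2 with hD
    have hlow : ∀ᶠ n : ℕ in atTop, a < L - ε / (2 * Δ) + (C - c) / n - D / √n := by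
      have h : Tendsto (fun n : ℕ => L - ε / (2 * Δ) + (C - c) / n - D / √n) atTop
          (nhds (L - ε / (2 * Δ) + 0 - 0)) := (tendsto_const_nhds.add (hlim _)).sub (hlim' _)
      refine h.eventually_const_lt ?_
      have : ε / (2 * Δ) = (L - a) / 2 := by rw [hε]; field_simp
      linarith
    filter_upwards [hlow, eventually_gt_atTop 0] with n h1 hn
    have hn' : (0 : ℝ) < n := by exact_mod_cast hn
    have hs : (0 : ℝ) < √n := Real.sqrt_pos.2 hn'
    have hub := integral_mul_log_partZ_spike_le (p := p) hΔ hq hn hB hM fun m _ => hl m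
    refine h1.trans_le ?_
    rw [hMI n hn, le_div_iff₀ hn']
    have e1 : (L - ε / (2 * Δ) + (C - c) / n - D / √n) * n
        = n * (L - ε / (2 * Δ)) + (C - c) - √n * D := by
      have : (n : ℝ) = √n * √n := (Real.mul_self_sqrt hn'.le).symm
      have e2 : D / √n * n = √n * D := by
        rw [div_mul_eq_mul_div, div_eq_iff hs.ne']
        linear_combination D * this
      rw [sub_mul, e2, add_mul, div_mul_cancel₀ _ hn'.ne']
      ring
    have e3 : n * (E q - q ^ 2 / (2 * Δ) + q ^ 2 / (4 * Δ) + ε / (2 * Δ))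
        = n * (V ^ 2 / (4 * Δ)) - n * (L - ε / (2 * Δ)) := by
      rw [hLdef, eq0]
      field_simp
      ring
    rw [e1]
    rw [e3] at hub
    have e4 : √n / 2 * ∑ m ∈ M, (Var[siteLog p v Δ q m; p.prod (gaussianReal 0 1)] + 1)
      = √n * D := by rw [hD]; ring
    rw [e4] at hub
    linarith
  · have hup : ∀ᶠ n : ℕ in atTop, L + C / n < a := by
      have h : Tendsto (fun n : ℕ => L + C / n) atTop (nhds (L + 0)) :=
        tendsto_const_nhds.add (hlim _)
      exact h.eventually_lt_const (by linarith)
    filter_upwards [hup, eventually_gt_atTop 0] with n h1 hn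
    have hn' : (0 : ℝ) < n := by exact_mod_cast hn
    have hlb := le_integral_mul_log_partZ_spike (v := v) (p := p) hΔ hq hn
    refine lt_of_le_of_lt ?_ h1
    rw [hMI n hn, div_le_iff₀ hn', add_mul, div_mul_cancel₀ _ hn'.ne']
    have e3 : L * n = n * (V ^ 2 / (4 * Δ)) - (n * E q - n * q ^ 2 / (4 * Δ)) := by
      rw [hLdef, eq0]; ring
    linarith

end MutualInformationLimit

/-- **Exactness of the Bethe mutual information** : if moreover the minimizer of `i_L`
coincides with `m̂` (i.e. `i_L(m) ≥ i_L(m̂)` for all `m`), then `I(x*;Y)/n` converges and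
its limit is `i_B(m̂) = min_{m ≥ 0} i_B(m)`. -/
theorem bethe_exact (p : Measure ℝ) [IsProbabilityMeasure p]
    (hsupp : ∃ s : Finset ℝ, p (↑s : Set ℝ)ᶜ = 0)
    (Δ : ℝ) (hΔ : 0 < Δ) (mhat : ℝ) (hmhat : 0 ≤ mhat)
    (hmin : ∀ m : ℝ, 0 ≤ m → iB p Δ mhat ≤ iB p Δ m)
    (hfin : {m : ℝ | deriv (iL p Δ mhat) m = 0}.Finite)
    (hL : ∀ m : ℝ, iL p Δ mhat mhat ≤ iL p Δ mhat m) :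
    Tendsto (fun n : ℕ => MI p Δ n / n) atTop (nhds (iB p Δ mhat)) := by
  obtain ⟨s, hs⟩ := hsupp
  have hv : MeasurableEmbedding (Subtype.val : s → ℝ) :=
    measurableEmbedding_of_injective_of_countable Subtype.val_injective
  have hp : (p.comap (Subtype.val : s → ℝ)).map Subtype.val = p := by
    rw [hv.map_comap]
    refine Measure.restrict_eq_self_of_ae_mem ?_
    rw [Subtype.range_coe_subtype]
    exact hs
  have : IsProbabilityMeasure (p.comap (Subtype.val : s → ℝ)) := ⟨by
    rw [← Set.preimage_univ (f := (Subtype.val : s → ℝ)), ← hv.map_apply, hp, measure_univ]⟩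
  rw [← hp] at hL ⊢
  exact tendsto_MI_map hv hΔ hmhat hL
end
end

section
/- For every n ≥ 1, the mutual information satisfies the exact identity I(x*;Y) = −E[log Z(Y)] + (1/(2nΔ))·Σ_{1≤i≤j≤n} E[(x*_i)² (x*_j)²], where the sum equals (n(n−1)/2)·(E_p[X²])² + n·E_p[X⁴]. -/
open MeasureTheory ProbabilityTheory Filter Real

noncomputable section

/-- The log-partition function `log Z(Y)` of the rank-one estimation problem. -/
def logZ (p : Measure ℝ) (Δ : ℝ) (n : ℕ) (Y : SymIdx n → ℝ) : ℝ :=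
  Real.log (∫ x : Fin n → ℝ,
    Real.exp (∑ q : SymIdx n,
      (-(x q.1.1 ^ 2 * x q.1.2 ^ 2) / (2 * n * Δ)
        + x q.1.1 * x q.1.2 * Y q / (Real.sqrt n * Δ)))
    ∂(Measure.pi fun _ : Fin n => p))

/-! ### Product measures and densities -/

lemma lintegral_pi_prod_eq_prod {ι : Type*} [Fintype ι] {X : ι → Type*}
    [∀ i, MeasurableSpace (X i)] (μ : ∀ i, Measure (X i)) [∀ i, IsProbabilityMeasure (μ i)]
    {f : ∀ i, X i → ENNReal} (hf : ∀ i, Measurable (f i)) :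
    ∫⁻ x, ∏ i, f i (x i) ∂(Measure.pi μ) = ∏ i, ∫⁻ x, f i x ∂(μ i) := by
  have hind : iIndepFun (fun i (x : ∀ i, X i) => f i (x i)) (Measure.pi μ) :=
    iIndepFun_pi fun i => (hf i).aemeasurable
  have h := lintegral_prod_eq_prod_lintegral_of_indepFun Finset.univ
    (fun i (x : ∀ i, X i) => f i (x i)) hind (fun i => (hf i).comp (measurable_pi_apply i))
  refine h.trans (Finset.prod_congr rfl fun i _ => ?_)
  exact (measurePreserving_eval μ i).lintegral_comp (hf i)

lemma pi_withDensity_eq {ι : Type*} [Fintype ι] {X : ι → Type*}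
    [∀ i, MeasurableSpace (X i)] (μ : ∀ i, Measure (X i)) [∀ i, IsProbabilityMeasure (μ i)]
    {f : ∀ i, X i → ENNReal} (hf : ∀ i, Measurable (f i))
    [∀ i, SigmaFinite ((μ i).withDensity (f i))] :
    Measure.pi (fun i => (μ i).withDensity (f i))
      = (Measure.pi μ).withDensity (fun x => ∏ i, f i (x i)) := by
  refine Measure.pi_eq fun s hs => ?_
  rw [withDensity_apply _ (MeasurableSet.univ_pi hs),
    ← lintegral_indicator (MeasurableSet.univ_pi hs)]
  have h : (Set.univ.pi s).indicator (fun x : ∀ i, X i => ∏ i, f i (x i))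
      = fun x => ∏ i, (s i).indicator (f i) (x i) := by
    ext x
    by_cases hx : x ∈ Set.univ.pi s
    · rw [Set.indicator_of_mem hx]
      exact Finset.prod_congr rfl fun i _ =>
        (Set.indicator_of_mem (hx i (Set.mem_univ i)) _).symm
    · rw [Set.indicator_of_notMem hx]
      simp only [Set.mem_pi, Set.mem_univ, true_implies, not_forall] at hx
      obtain ⟨i, hi⟩ := hx
      exact (Finset.prod_eq_zero (Finset.mem_univ i) (Set.indicator_of_notMem hi _)).symm
  rw [h, lintegral_pi_prod_eq_prod μ fun i => (hf i).indicator (hs i)]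
  refine Finset.prod_congr rfl fun i _ => ?_
  rw [lintegral_indicator (hs i), withDensity_apply _ (hs i)]

/-! ### Gaussian shifts -/

lemma gaussianReal_eq_withDensity_exp (m : ℝ) {v : NNReal} (hv : v ≠ 0) :
    gaussianReal m v
      = (gaussianReal 0 v).withDensity
          (fun x => ENNReal.ofReal (exp (-m ^ 2 / (2 * v) + m * x / v))) := by
  rw [gaussianReal_of_var_ne_zero m hv, gaussianReal_of_var_ne_zero 0 hv,
    ← withDensity_mul _ (measurable_gaussianPDF 0 v) (by fun_prop)]
  congr 1
  ext x
  have hv' : (v : ℝ) ≠ 0 := by exact_mod_cast hv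
  rw [Pi.mul_apply, gaussianPDF, gaussianPDF, ← ENNReal.ofReal_mul (gaussianPDFReal_nonneg _ _ _),
    gaussianPDFReal, gaussianPDFReal,
    mul_assoc (√(2 * π * v))⁻¹, ← exp_add]
  congr 3
  field_simp
  ring

/-- The law of a Gaussian vector of variance `Δ` with mean `a`, as a density with respect to the
centred one. -/
lemma pi_gaussian_shift {ι : Type*} [Fintype ι] (a : ι → ℝ) {Δ : ℝ} (hΔ : 0 < Δ) :
    (Measure.pi fun _ : ι => gaussianReal 0 1).map (fun w q => a q + √Δ * w q)
      = (Measure.pi fun _ : ι => gaussianReal 0 Δ.toNNReal).withDensity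
          (fun y => ENNReal.ofReal (exp (∑ q, (-a q ^ 2 / (2 * Δ) + a q * y q / Δ)))) := by
  have hv : Δ.toNNReal ≠ 0 := by simpa using hΔ
  have hmap (m : ℝ) : (gaussianReal 0 1).map (fun x => m + √Δ * x)
      = gaussianReal m Δ.toNNReal := by
    have : (fun x => m + √Δ * x) = (fun x => m + x) ∘ (fun x => √Δ * x) := rfl
    rw [this, ← Measure.map_map (by fun_prop) (by fun_prop), gaussianReal_map_const_mul,
      gaussianReal_map_const_add]
    congr 1
    · simp
    · ext
      simp [Real.sq_sqrt hΔ.le, hΔ.le]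
  have hprob (q : ι) : IsProbabilityMeasure ((gaussianReal 0 1).map (fun x => a q + √Δ * x)) := by
    rw [hmap]; infer_instance
  rw [Measure.pi_map_pi (f := fun q x => a q + √Δ * x) (fun q => by fun_prop)]
  simp_rw [hmap]
  have hdens (q : ι) := gaussianReal_eq_withDensity_exp (a q) hv
  have hprob' (q : ι) : IsProbabilityMeasure ((gaussianReal 0 Δ.toNNReal).withDensity
      (fun x => ENNReal.ofReal (exp (-a q ^ 2 / (2 * Δ.toNNReal) + a q * x / Δ.toNNReal)))) := by
    rw [← hdens]; infer_instance
  simp_rw [hdens]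
  rw [pi_withDensity_eq _ (fun q => by fun_prop)]
  congr 1
  ext y
  rw [← ENNReal.ofReal_prod_of_nonneg (fun _ _ => (exp_pos _).le), exp_sum]
  simp [Real.coe_toNNReal _ hΔ.le]

lemma map_prod_gaussian_shift {α ι : Type*} [MeasurableSpace α] [Fintype ι]
    (P : Measure α) [SFinite P] {a : α → ι → ℝ} (ha : Measurable a) {Δ : ℝ} (hΔ : 0 < Δ) :
    (P.prod (Measure.pi fun _ : ι => gaussianReal 0 1)).map
        (fun w => (w.1, fun q => a w.1 q + √Δ * w.2 q))
      = (P.prod (Measure.pi fun _ : ι => gaussianReal 0 Δ.toNNReal)).withDensity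
          (fun w => ENNReal.ofReal
            (exp (∑ q, (-a w.1 q ^ 2 / (2 * Δ) + a w.1 q * w.2 q / Δ)))) := by
  have hL : Measurable fun w : α × (ι → ℝ) => ENNReal.ofReal
      (exp (∑ q, (-a w.1 q ^ 2 / (2 * Δ) + a w.1 q * w.2 q / Δ))) := by fun_prop
  have hT : Measurable fun w : α × (ι → ℝ) => (w.1, fun q => a w.1 q + √Δ * w.2 q) := by
    fun_prop
  refine Measure.ext_of_lintegral _ fun f hf => ?_
  rw [lintegral_map hf hT, lintegral_withDensity_eq_lintegral_mul _ hL hf,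
    lintegral_prod (fun w : α × (ι → ℝ) => f (w.1, fun q => a w.1 q + √Δ * w.2 q))
      (hf.comp hT).aemeasurable,
    lintegral_prod _ (hL.mul hf).aemeasurable]
  refine lintegral_congr fun x => ?_
  have hfx : Measurable fun y => f (x, y) := hf.comp measurable_prodMk_left
  have h := lintegral_map (μ := Measure.pi fun _ : ι => gaussianReal 0 1) hfx
    (g := fun w q => a x q + √Δ * w q) (by fun_prop)
  rw [← h, pi_gaussian_shift (a x) hΔ,
    lintegral_withDensity_eq_lintegral_mul _ (by fun_prop) hfx]
  rfl

/-! ### Log-likelihood ratio against the product of the marginals -/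

lemma llr_prod_marginals {α β : Type*} [MeasurableSpace α] [MeasurableSpace β]
    (P : Measure α) [IsProbabilityMeasure P] (ν : Measure β) [SigmaFinite ν]
    {g : α × β → ℝ} (hg : Measurable g)
    (hint : ∀ y, Integrable (fun x => exp (g (x, y))) P)
    (μ : Measure (α × β)) [IsProbabilityMeasure μ] (hfst : μ.fst = P)
    (hμ : μ = (P.prod ν).withDensity (fun w => ENNReal.ofReal (exp (g w)))) :
    llr μ (μ.fst.prod μ.snd) =ᵐ[μ] fun w => g w - log (∫ x, exp (g (x, w.2)) ∂P) := by
  set Z : β → ℝ := fun y => ∫ x, exp (g (x, y)) ∂P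
  have hZpos (y : β) : 0 < Z y := integral_exp_pos (hint y)
  have hZm : Measurable Z := by
    have : StronglyMeasurable fun w : α × β => exp (g w) :=
      (measurable_exp.comp hg).stronglyMeasurable
    exact this.integral_prod_left'.measurable
  have hZ (y : β) : ∫⁻ x, ENNReal.ofReal (exp (g (x, y))) ∂P = ENNReal.ofReal (Z y) :=
    (ofReal_integral_eq_lintegral_ofReal (hint y) (ae_of_all _ fun _ => (exp_pos _).le)).symm
  have hsnd : μ.snd = ν.withDensity (fun y => ENNReal.ofReal (Z y)) := by
    refine Measure.ext_of_lintegral _ fun f hf => ?_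
    rw [Measure.snd, lintegral_map hf measurable_snd, hμ,
      lintegral_withDensity_eq_lintegral_mul (P.prod ν) (by fun_prop)
        (g := fun w => f w.2) (hf.comp measurable_snd),
      lintegral_withDensity_eq_lintegral_mul _ (by fun_prop) hf,
      lintegral_prod_symm' _ (by fun_prop)]
    refine lintegral_congr fun y => ?_
    simp only [Pi.mul_apply]
    rw [lintegral_mul_const _ (by fun_prop), hZ]
  have hprod : μ.fst.prod μ.snd
      = (P.prod ν).withDensity (fun w => ENNReal.ofReal (Z w.2)) := by
    have : SFinite (ν.withDensity (fun y => ENNReal.ofReal (Z y))) := by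
      rw [← hsnd]; infer_instance
    rw [hfst, hsnd, prod_withDensity_right (by fun_prop)]
  have hdens : μ = (μ.fst.prod μ.snd).withDensity
      (fun w => ENNReal.ofReal (exp (g w) / Z w.2)) := by
    rw [hprod, ← withDensity_mul _ (by fun_prop) (by fun_prop)]
    refine hμ.trans ?_
    congr 1
    ext w
    rw [Pi.mul_apply, ← ENNReal.ofReal_mul (hZpos _).le, mul_div_cancel₀ _ (hZpos _).ne']
  have hac : μ ≪ μ.fst.prod μ.snd := by
    conv_lhs => rw [hdens]
    exact withDensity_absolutelyContinuous _ _
  have hrn := Measure.rnDeriv_withDensity (μ.fst.prod μ.snd)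
    (f := fun w => ENNReal.ofReal (exp (g w) / Z w.2)) (by fun_prop)
  rw [← hdens] at hrn
  filter_upwards [hac.ae_le hrn] with w hw
  rw [llr, hw, ENNReal.toReal_ofReal (div_nonneg (exp_pos _).le (hZpos _).le),
    log_div (exp_pos _).ne' (hZpos _).ne', log_exp]

/-! ### Boundedness -/

lemma abs_log_integral_exp_le {α : Type*} [MeasurableSpace α] (P : Measure α)
    [IsProbabilityMeasure P] {g : α → ℝ} {B : ℝ} (hint : Integrable (fun x => exp (g x)) P)
    (hB : ∀ᵐ x ∂P, |g x| ≤ B) : |log (∫ x, exp (g x) ∂P)| ≤ B := by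
  have h1 : exp (-B) ≤ ∫ x, exp (g x) ∂P := by
    have := integral_mono_ae (integrable_const (exp (-B))) hint
      (hB.mono fun x hx => exp_le_exp.2 (neg_le_of_abs_le hx))
    simpa using this
  have h2 : ∫ x, exp (g x) ∂P ≤ exp B := by
    have := integral_mono_ae hint (integrable_const (exp B))
      (hB.mono fun x hx => exp_le_exp.2 (le_of_abs_le hx))
    simpa using this
  have hpos := (exp_pos (-B)).trans_le h1
  exact abs_le.2 ⟨(le_log_iff_exp_le hpos).2 h1, (log_le_iff_le_exp hpos).2 h2⟩

lemma exists_ae_abs_le_of_finite_support {p : Measure ℝ}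
    (hsupp : ∃ s : Finset ℝ, p (↑s : Set ℝ)ᶜ = 0) :
    ∃ M : ℝ, ∀ᵐ x ∂p, |x| ≤ M := by
  obtain ⟨s, hs⟩ := hsupp
  refine ⟨∑ y ∈ s, |y|, ?_⟩
  have : ∀ᵐ x ∂p, x ∈ (↑s : Set ℝ) := hs
  filter_upwards [this] with x hx
  exact Finset.single_le_sum (f := fun y : ℝ => |y|) (fun _ _ => abs_nonneg _)
    (Finset.mem_coe.1 hx)

lemma ae_pi_abs_le {ι : Type*} [Fintype ι] {p : Measure ℝ} [IsProbabilityMeasure p] {M : ℝ}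
    (hM : ∀ᵐ x ∂p, |x| ≤ M) :
    ∀ᵐ x ∂(Measure.pi fun _ : ι => p), ∀ i, |x i| ≤ M :=
  ae_all_iff.2 fun i => (measurePreserving_eval (fun _ : ι => p) i).quasiMeasurePreserving.ae hM

/-! ### Second-moment sums -/

lemma sum_symIdx_ite (n : ℕ) (b c : ℝ) :
    ∑ q : SymIdx n, (if q.1.1 = q.1.2 then b else c) = (n * (n - 1 : ℝ) / 2) * c + n * b := by
  have h1 : ∑ q : SymIdx n, (if q.1.1 = q.1.2 then b else c)
      = ∑ j : Fin n, ∑ i : Fin n, if i ≤ j then (if i = j then b else c) else 0 := by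
    rw [← Finset.sum_subtype (Finset.univ.filter fun q : Fin n × Fin n => q.1 ≤ q.2)
      (by simp) (fun q : Fin n × Fin n => if q.1 = q.2 then b else c), Finset.sum_filter,
      Fintype.sum_prod_type_right]
  have h2 (j : Fin n) : (∑ i : Fin n, if i ≤ j then (if i = j then b else c) else 0)
      = j * c + b := by
    have (i : Fin n) : (if i ≤ j then (if i = j then b else c) else 0)
        = (if i < j then c else 0) + (if i = j then b else 0) := by
      rcases lt_trichotomy i j with h | h | h
      · simp [h, h.le, h.ne]
      · simp [h]
      · simp [h.not_ge, h.not_gt, h.ne']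
    simp only [this, Finset.sum_add_distrib, Finset.sum_ite_eq', Finset.mem_univ, if_true]
    rw [← Finset.sum_filter, Finset.sum_const, nsmul_eq_mul]
    congr 3
    have : (Finset.univ.filter fun i : Fin n => i < j) = Finset.Iio j := by ext; simp
    rw [this, Fin.card_Iio]
  rw [h1, Finset.sum_congr rfl fun j _ => h2 j, Finset.sum_add_distrib, ← Finset.sum_mul,
    Fin.sum_univ_eq_sum_range (fun i => (i : ℝ)) n]
  have h3 : ∑ i ∈ Finset.range n, (i : ℝ) = n * (n - 1 : ℝ) / 2 := by
    clear h1 h2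
    induction n with
    | zero => simp
    | succ k ih => rw [Finset.sum_range_succ, ih]; push_cast; ring
  rw [h3]
  simp

lemma integral_pi_sq_mul_sq {ι : Type*} [Fintype ι] [DecidableEq ι] (p : Measure ℝ)
    [IsProbabilityMeasure p] (i j : ι) :
    ∫ x, x i ^ 2 * x j ^ 2 ∂(Measure.pi fun _ : ι => p)
      = if i = j then ∫ x, x ^ 4 ∂p else (∫ x, x ^ 2 ∂p) ^ 2 := by
  have hev (k : ι) : ∫ x : ι → ℝ, x k ^ 2 ∂(Measure.pi fun _ => p) = ∫ x, x ^ 2 ∂p :=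
    integral_comp_eval (μ := fun _ : ι => p) (f := fun x : ℝ => x ^ 2) (by fun_prop)
  split_ifs with h
  · subst h
    simp_rw [← pow_add]
    exact integral_comp_eval (μ := fun _ : ι => p) (f := fun x : ℝ => x ^ 4) (by fun_prop)
  · have hind : iIndepFun (fun k (x : ι → ℝ) => x k ^ 2) (Measure.pi fun _ : ι => p) :=
      iIndepFun_pi (X := fun _ (x : ℝ) => x ^ 2) fun k => by fun_prop
    rw [(hind.indepFun h).integral_fun_mul_eq_mul_integral
      (((measurable_pi_apply i).pow_const 2).aestronglyMeasurable)
      (((measurable_pi_apply j).pow_const 2).aestronglyMeasurable), hev, hev,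
      sq]

/-- The log-likelihood of `x` given `Y`, up to terms that do not depend on `x`. -/
def logLik (Δ : ℝ) (n : ℕ) (w : (Fin n → ℝ) × (SymIdx n → ℝ)) : ℝ :=
  ∑ q : SymIdx n, (-(w.1 q.1.1 ^ 2 * w.1 q.1.2 ^ 2) / (2 * n * Δ)
    + w.1 q.1.1 * w.1 q.1.2 * w.2 q / (√n * Δ))

lemma measurable_logLik (Δ : ℝ) (n : ℕ) : Measurable (logLik Δ n) := by
  unfold logLik; fun_prop

lemma gaussJoint_eq_withDensity (p : Measure ℝ) [IsProbabilityMeasure p] {Δ : ℝ} (hΔ : 0 < Δ)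
    (n : ℕ) :
    gaussJoint p Δ n = ((Measure.pi fun _ : Fin n => p).prod
      (Measure.pi fun _ : SymIdx n => gaussianReal 0 Δ.toNNReal)).withDensity
        (fun w => ENNReal.ofReal (exp (logLik Δ n w))) := by
  rw [gaussJoint, map_prod_gaussian_shift (Measure.pi fun _ : Fin n => p)
    (a := fun x (q : SymIdx n) => x q.1.1 * x q.1.2 / √n) (by fun_prop) hΔ]
  congr 1
  ext w
  congr 2
  refine Finset.sum_congr rfl fun q _ => ?_
  rw [div_pow, Real.sq_sqrt n.cast_nonneg]
  congr 1
  · rw [mul_pow, neg_div', div_div]; ring_nf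
  · ring

lemma measurable_channel (Δ : ℝ) (n : ℕ) :
    Measurable fun w : (Fin n → ℝ) × (SymIdx n → ℝ) =>
      (w.1, fun q : SymIdx n => w.1 q.1.1 * w.1 q.1.2 / √n + √Δ * w.2 q) := by
  fun_prop

instance (p : Measure ℝ) [IsProbabilityMeasure p] (Δ : ℝ) (n : ℕ) :
    IsProbabilityMeasure (gaussJoint p Δ n) :=
  Measure.isProbabilityMeasure_map (measurable_channel Δ n).aemeasurable

lemma fst_gaussJoint (p : Measure ℝ) [IsProbabilityMeasure p] (Δ : ℝ) (n : ℕ) :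
    (gaussJoint p Δ n).fst = Measure.pi fun _ : Fin n => p := by
  rw [Measure.fst, gaussJoint, Measure.map_map measurable_fst (measurable_channel Δ n)]
  exact Measure.fst_prod

lemma abs_logLik_le {Δ : ℝ} (hΔ : 0 < Δ) {n : ℕ} {M : ℝ} {x : Fin n → ℝ}
    (hx : ∀ i, |x i| ≤ M) (Y : SymIdx n → ℝ) :
    |logLik Δ n (x, Y)|
      ≤ ∑ q : SymIdx n, (M ^ 2 * M ^ 2 / (2 * n * Δ) + M * M * |Y q| / (√n * Δ)) := by
  refine (Finset.abs_sum_le_sum_abs _ _).trans (Finset.sum_le_sum fun q _ => ?_)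
  refine (abs_add_le _ _).trans ?_
  have h1 := hx q.1.1
  have h2 := hx q.1.2
  have hM : 0 ≤ M := (abs_nonneg _).trans h1
  rw [abs_div, abs_div, abs_of_nonneg (by positivity : 0 ≤ 2 * (n : ℝ) * Δ),
    abs_of_nonneg (by positivity : 0 ≤ √(n : ℝ) * Δ)]
  simp only [abs_neg, abs_mul, abs_pow]
  gcongr

lemma integrable_mul_coord {p : Measure ℝ} [IsProbabilityMeasure p] {n : ℕ} {M : ℝ}
    (hM : ∀ᵐ x ∂p, |x| ≤ M) (i j : Fin n) (k : ℕ) :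
    Integrable (fun x => x i ^ k * x j ^ k) (Measure.pi fun _ : Fin n => p) := by
  refine Integrable.of_bound (by fun_prop) (M ^ k * M ^ k) ?_
  filter_upwards [ae_pi_abs_le (ι := Fin n) hM] with x hx
  have hM : 0 ≤ M := (abs_nonneg _).trans (hx i)
  rw [Real.norm_eq_abs, abs_mul, abs_pow, abs_pow]
  gcongr <;> exact hx _

lemma integrable_exp_logLik {p : Measure ℝ} [IsProbabilityMeasure p] {Δ : ℝ} (hΔ : 0 < Δ) {n : ℕ}
    {M : ℝ} (hM : ∀ᵐ x ∂p, |x| ≤ M) (Y : SymIdx n → ℝ) :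
    Integrable (fun x => exp (logLik Δ n (x, Y))) (Measure.pi fun _ : Fin n => p) := by
  have hm := measurable_logLik Δ n
  refine Integrable.of_bound
    (measurable_exp.comp (hm.comp measurable_prodMk_right)).aestronglyMeasurable
    (exp (∑ q : SymIdx n, (M ^ 2 * M ^ 2 / (2 * n * Δ) + M * M * |Y q| / (√n * Δ)))) ?_
  filter_upwards [ae_pi_abs_le (ι := Fin n) hM] with x hx
  rw [Real.norm_eq_abs, abs_exp, exp_le_exp]
  exact (le_abs_self _).trans (abs_logLik_le hΔ hx Y)

lemma logZ_eq (p : Measure ℝ) (Δ : ℝ) (n : ℕ) (Y : SymIdx n → ℝ) :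
    logZ p Δ n Y = log (∫ x, exp (logLik Δ n (x, Y)) ∂(Measure.pi fun _ : Fin n => p)) := rfl

lemma measurable_logZ (p : Measure ℝ) [IsProbabilityMeasure p] (Δ : ℝ) (n : ℕ) :
    Measurable (logZ p Δ n) := by
  have : StronglyMeasurable fun w => exp (logLik Δ n w) :=
    (measurable_exp.comp (measurable_logLik Δ n)).stronglyMeasurable
  exact measurable_log.comp this.integral_prod_left'.measurable

lemma integrable_noise {ι : Type*} [Fintype ι] (q : ι) :
    Integrable (fun w : ι → ℝ => w q) (Measure.pi fun _ : ι => gaussianReal 0 1) :=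
  integrable_eval ((memLp_id_gaussianReal 1).integrable le_rfl)

lemma integrable_logZ_gaussJoint {p : Measure ℝ} [IsProbabilityMeasure p] {Δ : ℝ} (hΔ : 0 < Δ)
    {n : ℕ} {M : ℝ} (hM : ∀ᵐ x ∂p, |x| ≤ M) :
    Integrable (fun w => logZ p Δ n w.2) (gaussJoint p Δ n) := by
  have hbound (Y : SymIdx n → ℝ) : |logZ p Δ n Y|
      ≤ ∑ q : SymIdx n, (M ^ 2 * M ^ 2 / (2 * n * Δ) + M * M * |Y q| / (√n * Δ)) :=
    abs_log_integral_exp_le _ (integrable_exp_logLik hΔ hM Y)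
      ((ae_pi_abs_le hM).mono fun x hx => abs_logLik_le hΔ hx Y)
  have hmeas : Measurable fun w : (Fin n → ℝ) × (SymIdx n → ℝ) => logZ p Δ n w.2 :=
    (measurable_logZ p Δ n).comp measurable_snd
  refine Integrable.mono' ?_ hmeas.aestronglyMeasurable (ae_of_all _ fun w => hbound w.2)
  refine integrable_finsetSum _ fun q _ => (integrable_const _).add ?_
  refine (Integrable.const_mul ?_ _).div_const _
  refine Integrable.abs ?_
  rw [gaussJoint, integrable_map_measure (by fun_prop) (measurable_channel Δ n).aemeasurable]
  have h := integrable_mul_coord hM q.1.1 q.1.2 1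
  simp only [pow_one] at h
  exact ((h.comp_fst _).div_const _).add (((integrable_noise q).comp_snd _).const_mul _)

/-- The log-likelihood is integrable under the joint law, with explicit expectation. -/
lemma integrable_and_integral_logLik {p : Measure ℝ} [IsProbabilityMeasure p] {Δ : ℝ}
    (hΔ : 0 < Δ) {n : ℕ} (hn : 1 ≤ n) {M : ℝ} (hM : ∀ᵐ x ∂p, |x| ≤ M) :
    Integrable (logLik Δ n) (gaussJoint p Δ n) ∧
      ∫ w, logLik Δ n w ∂(gaussJoint p Δ n)
        = (1 / (2 * n * Δ))
          * ((n * (n - 1 : ℝ) / 2) * (∫ x, x ^ 2 ∂p) ^ 2 + n * ∫ x, x ^ 4 ∂p) := by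
  have hn' : (0 : ℝ) < n := by exact_mod_cast hn
  set P := Measure.pi fun _ : Fin n => p
  set G := Measure.pi fun _ : SymIdx n => gaussianReal 0 1
  have hm := (measurable_logLik Δ n).aestronglyMeasurable (μ := gaussJoint p Δ n)
  have hT := (measurable_channel Δ n).aemeasurable (μ := P.prod G)
  have hcomp (w : (Fin n → ℝ) × (SymIdx n → ℝ)) :
      logLik Δ n (w.1, fun q : SymIdx n => w.1 q.1.1 * w.1 q.1.2 / √n + √Δ * w.2 q)
        = ∑ q : SymIdx n, (1 / (2 * n * Δ) * (w.1 q.1.1 ^ 2 * w.1 q.1.2 ^ 2)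
            + √Δ / (√n * Δ) * (w.1 q.1.1 * w.1 q.1.2 * w.2 q)) := by
    refine Finset.sum_congr rfl fun q _ => ?_
    have hs : √(n : ℝ) ≠ 0 := (Real.sqrt_pos.2 hn').ne'
    have hs2 : (n : ℝ) = √(n : ℝ) ^ 2 := (Real.sq_sqrt hn'.le).symm
    simp only
    rw [hs2, Real.sqrt_sq (Real.sqrt_nonneg _)]
    field_simp
    ring
  have hi1 (q : SymIdx n) : Integrable (fun w : (Fin n → ℝ) × (SymIdx n → ℝ) =>
      1 / (2 * n * Δ) * (w.1 q.1.1 ^ 2 * w.1 q.1.2 ^ 2)) (P.prod G) :=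
    ((integrable_mul_coord hM q.1.1 q.1.2 2).comp_fst _).const_mul _
  have hi2 (q : SymIdx n) : Integrable (fun w : (Fin n → ℝ) × (SymIdx n → ℝ) =>
      √Δ / (√n * Δ) * (w.1 q.1.1 * w.1 q.1.2 * w.2 q)) (P.prod G) := by
    have h := integrable_mul_coord hM q.1.1 q.1.2 1
    simp only [pow_one] at h
    exact (h.mul_prod (integrable_noise q)).const_mul _
  constructor
  · rw [gaussJoint] at hm ⊢
    rw [integrable_map_measure hm hT]
    exact (integrable_finsetSum _ fun q _ => (hi1 q).add (hi2 q)).congr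
      (ae_of_all _ fun w => (hcomp w).symm)
  · rw [gaussJoint] at hm ⊢
    rw [integral_map hT hm]
    simp_rw [hcomp]
    rw [integral_finsetSum Finset.univ (f := fun q (w : (Fin n → ℝ) × (SymIdx n → ℝ)) =>
      1 / (2 * n * Δ) * (w.1 q.1.1 ^ 2 * w.1 q.1.2 ^ 2)
        + √Δ / (√n * Δ) * (w.1 q.1.1 * w.1 q.1.2 * w.2 q))
      fun q _ => (hi1 q).add (hi2 q), ← sum_symIdx_ite, Finset.mul_sum]
    refine Finset.sum_congr rfl fun q _ => ?_
    rw [integral_add (hi1 q) (hi2 q), integral_const_mul, integral_const_mul,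
      integral_prod_mul (fun x : Fin n → ℝ => x q.1.1 * x q.1.2) (fun y : SymIdx n → ℝ => y q),
      integral_fun_fst (fun x : Fin n → ℝ => x q.1.1 ^ 2 * x q.1.2 ^ 2),
      integral_pi_sq_mul_sq, integral_eval, integral_id_gaussianReal]
    simp

/-- **Mutual information–free energy identity** :
`I(x*;Y) = −E[log Z(Y)] + (1/(2nΔ)) Σ_{i≤j} E[(x*_i)²(x*_j)²]`, where the sum equals
`(n(n−1)/2)(E_p[X²])² + n E_p[X⁴]`. -/
theorem mi_eq_free_energy (p : Measure ℝ) [IsProbabilityMeasure p]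
    (hsupp : ∃ s : Finset ℝ, p (↑s : Set ℝ)ᶜ = 0)
    (Δ : ℝ) (hΔ : 0 < Δ) (n : ℕ) (hn : 1 ≤ n) :
    MI p Δ n
      = -(∫ w, logZ p Δ n w.2 ∂(gaussJoint p Δ n))
        + (1 / (2 * n * Δ))
          * ((n * (n - 1 : ℝ) / 2) * (∫ x, x ^ 2 ∂p) ^ 2 + n * ∫ x, x ^ 4 ∂p) := by
  obtain ⟨M, hM⟩ := exists_ae_abs_le_of_finite_support hsupp
  have hllr := llr_prod_marginals _ _ (measurable_logLik Δ n) (integrable_exp_logLik hΔ hM)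
    (gaussJoint p Δ n) (fst_gaussJoint p Δ n) (gaussJoint_eq_withDensity p hΔ n)
  obtain ⟨hint, hval⟩ := integrable_and_integral_logLik hΔ hn hM
  rw [MI, mutualInfoR, klDivR, integral_congr_ae hllr]
  simp_rw [← logZ_eq]
  rw [integral_sub hint (integrable_logZ_gaussJoint hΔ hM), hval]
  ring
end
end

section
/- E[f(X, X')] = E[f(X, X*)] for every bounded measurable function f : Ω_X × Ω_X → ℝ (the Nishimori identity). -/
open MeasureTheory ProbabilityTheory

noncomputable section

/-- **Nishimori identity.** Let `μ` be a prior on a standard Borel space `ΩX`, `κ` an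
observation channel (Markov kernel) from `ΩX` to `ΩY`, and `π` a posterior kernel from
`ΩY` to `ΩX`, i.e. drawing `Y` from its marginal `ν = (μ ⊗ₘ κ).snd` and then `X ∼ π(Y,·)`
reproduces the joint law of `(X*, Y)`. If, conditionally on `Y`, `X` and `X'` are
independent samples from `π(Y,·)`, then `E[f(X,X')] = E[f(X,X*)]` for every bounded
measurable `f`. -/
theorem nishimori_identity
    {ΩX ΩY : Type*} [MeasurableSpace ΩX] [StandardBorelSpace ΩX]
    [MeasurableSpace ΩY] [StandardBorelSpace ΩY]
    (μ : Measure ΩX) [IsProbabilityMeasure μ]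
    (κ : Kernel ΩX ΩY) [IsMarkovKernel κ]
    (π : Kernel ΩY ΩX) [IsMarkovKernel π]
    (ν : Measure ΩY) (hν : ν = (μ.compProd κ).snd)
    (hpost : μ.compProd κ = (ν.compProd π).map Prod.swap)
    (f : ΩX × ΩX → ℝ) (hf : Measurable f) (hbdd : ∃ C : ℝ, ∀ w, |f w| ≤ C) :
    ∫ y, ∫ x, ∫ x', f (x, x') ∂(π y) ∂(π y) ∂ν
      = ∫ xstar, ∫ y, ∫ x, f (x, xstar) ∂(π y) ∂(κ xstar) ∂μ := by
  have : IsProbabilityMeasure ν := by rw [hν]; infer_instance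
  obtain ⟨C, hC⟩ := hbdd
  -- the conditional expectation of `f (X, x)` given `Y = y`, as a function of `(y, x)`
  let g : ΩY × ΩX → ℝ := fun z => ∫ x, f (x, z.2) ∂(π z.1)
  have hg : StronglyMeasurable g := by
    have hf' : StronglyMeasurable fun p : (ΩY × ΩX) × ΩX => f (p.2, p.1.2) :=
      (hf.comp (by fun_prop)).stronglyMeasurable
    exact hf'.integral_kernel_prod_right' (κ := π.comap Prod.fst measurable_fst)
  have hgC (z) : ‖g z‖ ≤ C := by
    simpa using norm_integral_le_of_norm_le_const (μ := π z.1) (f := fun x => f (x, z.2))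
      (Filter.Eventually.of_forall fun x => hC (x, z.2))
  have hswap : Integrable (g ∘ Prod.swap) (μ.compProd κ) :=
    Integrable.of_bound (hg.comp_measurable measurable_swap).aestronglyMeasurable C
      (Filter.Eventually.of_forall fun z => hgC z.swap)
  calc ∫ y, ∫ x, ∫ x', f (x, x') ∂(π y) ∂(π y) ∂ν
      = ∫ y, ∫ x', g (y, x') ∂(π y) ∂ν := by
        congr with y
        exact integral_integral_swap
          (Integrable.of_bound hf.aestronglyMeasurable C (Filter.Eventually.of_forall hC))
    _ = ∫ z, g z ∂(ν.compProd π) :=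
        (Measure.integral_compProd (Integrable.of_bound hg.aestronglyMeasurable C
          (Filter.Eventually.of_forall hgC))).symm
    _ = ∫ z, (g ∘ Prod.swap) z ∂(μ.compProd κ) := by
        rw [hpost, integral_map measurable_swap.aemeasurable
          (hg.comp_measurable measurable_swap).aestronglyMeasurable]
        rfl
    _ = ∫ xstar, ∫ y, ∫ x, f (x, xstar) ∂(π y) ∂(κ xstar) ∂μ :=
        Measure.integral_compProd hswap
end
end
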